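/- arXiv:1902.04847 — 4 statements merged into one kernel-verified Lean document; each statement's English description precedes it below -/
import Mathlib

section
/- Let n = 2^a p^b where p is a prime with p ≥ 7 and a, b ≥ 0 are integers with n ≥ 2. Then the quotient algebra E = (A#C_n)/(e₀) is finite-dimensional as a k-vector space (equivalently, GKdim E = 0, i.e. the pertinency p(A, C_n) equals n). -/
open scoped BigOperators

namespace NCIS

variable (k : Type*) [Field k] (n : ℕ)

/-- Relations defining the skew group algebra `A # C_n`, where
`A = k_{-1}[x_0, …, x_{n-1}]`: the generators are `x_i` (`Sum.inl i`) and `s` (`Sum.inr ()`),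
subject to `x_i x_j + x_j x_i = 0` for `i ≠ j`, `s^n = 1` and `s x_i = x_{i+1} s`. -/
inductive SGRel : FreeAlgebra k (ZMod n ⊕ Unit) → FreeAlgebra k (ZMod n ⊕ Unit) → Prop
  | anti (i j : ZMod n) (h : i ≠ j) :
      SGRel (FreeAlgebra.ι k (Sum.inl i) * FreeAlgebra.ι k (Sum.inl j)
           + FreeAlgebra.ι k (Sum.inl j) * FreeAlgebra.ι k (Sum.inl i)) 0
  | spow : SGRel (FreeAlgebra.ι k (Sum.inr ()) ^ n) 1
  | scomm (i : ZMod n) :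
      SGRel (FreeAlgebra.ι k (Sum.inr ()) * FreeAlgebra.ι k (Sum.inl i))
            (FreeAlgebra.ι k (Sum.inl (i + 1)) * FreeAlgebra.ι k (Sum.inr ()))

/-- The skew group algebra `A # C_n`. -/
abbrev SkewGroup := RingQuot (SGRel k n)

/-- The image of the generator `x_i` in `A # C_n`. -/
noncomputable def xg (i : ZMod n) : SkewGroup k n :=
  RingQuot.mkAlgHom k (SGRel k n) (FreeAlgebra.ι k (Sum.inl i))

/-- The image of the generator `s` in `A # C_n`. -/
noncomputable def sg : SkewGroup k n :=
  RingQuot.mkAlgHom k (SGRel k n) (FreeAlgebra.ι k (Sum.inr ()))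

/-- The integral `e₀ = (1/n) ∑_{i=0}^{n-1} s^i` in `A # C_n`. -/
noncomputable def e0 : SkewGroup k n := (n : k)⁻¹ • ∑ i ∈ Finset.range n, sg k n ^ i

/-- The quotient algebra `E = (A # C_n)/(e₀)` of `A # C_n` by the two-sided ideal
generated by `e₀`. -/
abbrev Equot := RingQuot (fun a b : SkewGroup k n => a = e0 k n ∧ b = 0)

end NCIS

namespace NCIS

open Finset

section Fourier

variable {k : Type*} [Field k] {M : Type*} [AddCommGroup M] [Module k M]

/-- The `m`-term Fourier sum of `f` at an `m`-th root of unity `ζ`. -/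
def fourierSum (m : ℕ) (f : ℕ → M) (ζ : k) : M := ∑ i ∈ range m, ζ ^ i • f i

theorem fourierSum_shift {m : ℕ} {f : ℕ → M} (hf : f m = f 0) {ζ : k} (hζ0 : ζ ≠ 0)
    (hζ : ζ ^ m = 1) :
    fourierSum m (fun i => f (i + 1)) ζ = ζ⁻¹ • fourierSum m f ζ := by
  have h : ζ • fourierSum m (fun i => f (i + 1)) ζ = fourierSum m f ζ := by
    have h1 := sum_range_succ (fun i => ζ ^ i • f i) m
    have h2 := sum_range_succ' (fun i => ζ ^ i • f i) m
    rw [h1, hζ, hf, pow_zero] at h2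
    simp only [fourierSum, smul_sum, smul_smul, ← pow_succ']
    exact (add_right_cancel h2).symm
  rw [← h, inv_smul_smul₀ hζ0]

open Classical in
theorem sum_pow_rootOfUnity {m : ℕ} {ζ : k} (hζ : ζ ^ m = 1) :
    ∑ i ∈ range m, ζ ^ i = if ζ = 1 then (m : k) else 0 := by
  split_ifs with h
  · simp [h]
  · have h1 := mul_geom_sum ζ m
    rw [hζ, sub_self] at h1
    exact (mul_eq_zero.mp h1).resolve_left (sub_ne_zero.mpr h)

open Classical in
theorem fourierSum_mul_add_mul {B : Type*} [Ring B] [Algebra k B] {m : ℕ} {x : ℕ → B} {c : k}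
    (hsq : ∀ i, x i * x i = c • (1 : B))
    (hanti : ∀ i < m, ∀ j < m, i ≠ j → x i * x j + x j * x i = 0)
    {ζ ξ : k} (hζ : ζ ^ m = 1) (hξ : ξ ^ m = 1) :
    fourierSum m x ζ * fourierSum m x ξ + fourierSum m x ξ * fourierSum m x ζ =
      (if ζ * ξ = 1 then (m : k) * (2 * c) else 0) • (1 : B) := by
  have h1 : fourierSum m x ζ * fourierSum m x ξ + fourierSum m x ξ * fourierSum m x ζ =
      ∑ i ∈ range m, ∑ j ∈ range m, (ζ ^ i * ξ ^ j) • (x i * x j + x j * x i) := by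
    simp only [fourierSum, sum_mul_sum, smul_add, sum_add_distrib]
    congr 1
    · simp only [smul_mul_smul_comm]
    · rw [sum_comm]
      simp only [smul_mul_smul_comm, mul_comm]
  have h2 : ∀ i ∈ range m, ∑ j ∈ range m, (ζ ^ i * ξ ^ j) • (x i * x j + x j * x i) =
      ((ζ * ξ) ^ i * (2 * c)) • (1 : B) := by
    intro i hi
    rw [sum_eq_single i]
    · rw [hsq, ← add_smul, smul_smul, mul_pow, two_mul]
    · intro j hj hji
      rw [hanti i (mem_range.mp hi) j (mem_range.mp hj) hji.symm, smul_zero]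
    · exact fun h => absurd hi h
  rw [h1, sum_congr rfl h2, ← sum_smul, ← sum_mul,
    sum_pow_rootOfUnity (by rw [mul_pow, hζ, hξ, one_mul]), ite_mul, zero_mul]

/-- An operator of order dividing `m` has an eigenvector. -/
theorem exists_eigenvector_of_pow_eq_one {m : ℕ} (hm : (m : k) ≠ 0) {ω : k}
    (hω : IsPrimitiveRoot ω m) {σ : Module.End k M} (hσ : σ ^ m = 1) {w : M} (hw : w ≠ 0) :
    ∃ (μ : k) (v : M), μ ^ m = 1 ∧ v ≠ 0 ∧ σ v = μ • v := by
  have hm0 : m ≠ 0 := by rintro rfl; simp at hm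
  have hω0 : ω ≠ 0 := hω.ne_zero hm0
  have hpow : ∀ j : ℕ, (ω ^ j) ^ m = 1 := fun j => by
    rw [← pow_mul, mul_comm, pow_mul, hω.pow_eq_one, one_pow]
  have hsum : ∑ j ∈ range m, fourierSum m (fun q => (σ ^ q) w) (ω ^ j) = (m : k) • w := by
    simp only [fourierSum]
    rw [sum_comm, sum_eq_single 0]
    · simp [← Nat.cast_smul_eq_nsmul k]
    · intro q hq hq0
      have h1 : ω ^ q ≠ 1 := hω.pow_ne_one_of_pos_of_lt hq0 (mem_range.mp hq)
      rw [← sum_smul]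
      have := sum_pow_rootOfUnity (hpow q)
      rw [if_neg h1] at this
      simp only [← pow_mul, mul_comm _ q] at this ⊢
      rw [this, zero_smul]
    · intro h; simp [Nat.pos_of_ne_zero hm0] at h
  have hne : ∃ j ∈ range m, fourierSum m (fun q => (σ ^ q) w) (ω ^ j) ≠ 0 := by
    by_contra! h
    rw [sum_eq_zero h] at hsum
    exact (smul_ne_zero hm hw) hsum.symm
  obtain ⟨j, -, hj⟩ := hne
  refine ⟨(ω ^ j)⁻¹, _, by rw [inv_pow, hpow, inv_one], hj, ?_⟩
  rw [← fourierSum_shift (by simp [hσ]) (pow_ne_zero _ hω0) (hpow j)]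
  simp [fourierSum, pow_succ']

end Fourier

section Fermions

variable {k : Type*} [Field k] {W : Type*} [AddCommGroup W] [Module k W]

/-- A family `x₀, …, x_{m-1}` of anticommuting operators with common scalar square,
permuted cyclically by an operator `σ` of order dividing `m`. -/
structure CyclicClifford (m : ℕ) (c : k) (x : ℕ → Module.End k W) (σ : Module.End k W) :
    Prop where
  sq : ∀ i, x i * x i = c • (1 : Module.End k W)
  anti : ∀ i < m, ∀ j < m, i ≠ j → x i * x j + x j * x i = 0
  periodic : x m = x 0
  comm : ∀ i, σ * x i = x (i + 1) * σ
  pow_eq_one : σ ^ m = 1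

namespace CyclicClifford

variable {m : ℕ} {c : k} {x : ℕ → Module.End k W} {σ : Module.End k W}

theorem apply_fourierSum (h : CyclicClifford m c x σ) {ζ μ : k} (hζ0 : ζ ≠ 0) (hζ : ζ ^ m = 1)
    {w : W} (hw : σ w = μ • w) :
    σ (fourierSum m x ζ w) = (ζ⁻¹ * μ) • fourierSum m x ζ w := by
  have h1 : σ * fourierSum m x ζ = (ζ⁻¹ • fourierSum m x ζ) * σ := by
    rw [← fourierSum_shift h.periodic hζ0 hζ]
    simp [fourierSum, mul_sum, sum_mul, h.comm]
  have h2 := LinearMap.congr_fun h1 w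
  simp only [Module.End.mul_apply, LinearMap.smul_apply, hw, map_smul, smul_smul] at h2
  rw [h2, mul_comm]

open Classical in
theorem fourierSum_apply_add (h : CyclicClifford m c x σ) {ζ ξ : k} (hζ : ζ ^ m = 1)
    (hξ : ξ ^ m = 1) (w : W) :
    fourierSum m x ζ (fourierSum m x ξ w) + fourierSum m x ξ (fourierSum m x ζ w) =
      (if ζ * ξ = 1 then (m : k) * (2 * c) else 0) • w := by
  exact LinearMap.congr_fun (fourierSum_mul_add_mul h.sq h.anti hζ hξ) w

/-- Starting from an eigenvector, one can reach an eigenvector killed by all lowering operators. -/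
theorem exists_vacuum (h : CyclicClifford m c x σ) {ω : k} (hω : IsPrimitiveRoot ω m)
    {μ : k} {w : W} (hμ : μ ^ m = 1) (hw0 : w ≠ 0) (hw : σ w = μ • w) (htwo : (2 : k) ≠ 0) (M : ℕ) :
    ∃ (ν : k) (v : W), ν ^ m = 1 ∧ v ≠ 0 ∧ σ v = ν • v ∧
      ∀ i, 1 ≤ i → i ≤ M → 2 * i < m → fourierSum m x (ω ^ i)⁻¹ v = 0 := by
  have hpow : ∀ j : ℕ, ((ω ^ j)⁻¹) ^ m = 1 := fun j => by
    rw [inv_pow, ← pow_mul, mul_comm, pow_mul, hω.pow_eq_one, one_pow, inv_one]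
  induction M with
  | zero => exact ⟨μ, w, hμ, hw0, hw, fun i h1 h2 => by omega⟩
  | succ M ih =>
    obtain ⟨ν, v, hν, hv0, hv, hkill⟩ := ih
    by_cases hM : 2 * (M + 1) < m
    swap
    · refine ⟨ν, v, hν, hv0, hv, fun i h1 h2 h3 => hkill i h1 ?_ h3⟩
      by_contra hlt
      have : i = M + 1 := by omega
      exact hM (this ▸ h3)
    have hω0 : ω ≠ 0 := hω.ne_zero (by omega)
    by_cases hz : fourierSum m x (ω ^ (M + 1))⁻¹ v = 0
    · refine ⟨ν, v, hν, hv0, hv, fun i h1 h2 h3 => ?_⟩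
      rcases Nat.lt_or_ge M i with h4 | h4
      · obtain rfl : i = M + 1 := by omega
        exact hz
      · exact hkill i h1 h4 h3
    · have hne : ∀ i, 1 ≤ i → i ≤ M + 1 → (ω ^ i)⁻¹ * (ω ^ (M + 1))⁻¹ ≠ 1 := by
        intro i h1 h2 h3
        rw [← mul_inv, ← pow_add, inv_eq_one] at h3
        exact hω.pow_ne_one_of_pos_of_lt (by omega) (by omega) h3
      refine ⟨_, _, ?_, hz, h.apply_fourierSum (inv_ne_zero (pow_ne_zero _ hω0)) (hpow _) hv, ?_⟩
      · rw [mul_pow, hν, inv_pow, hpow, inv_one, one_mul]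
      · intro i h1 h2 h3
        have h4 := h.fourierSum_apply_add (hpow i) (hpow (M + 1)) v
        rw [if_neg (hne i h1 h2), zero_smul] at h4
        rcases Nat.lt_or_ge M i with h5 | h5
        · obtain rfl : i = M + 1 := by omega
          rw [← two_smul k] at h4
          exact (smul_eq_zero.mp h4).resolve_left htwo
        · rwa [hkill i h1 h5 h3, map_zero, add_zero] at h4

/-- Starting from a vacuum vector, raising operators reach every eigenvalue `(ω ^ N)⁻¹ * μ`
with `N ≤ M (M + 1) / 2`. -/
theorem exists_raised (h : CyclicClifford m c x σ) {ω : k} (hω : IsPrimitiveRoot ω m)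
    (hc : (m : k) * (2 * c) ≠ 0) (M : ℕ) :
    ∀ (N : ℕ) (μ : k) (w : W), 2 * M ≤ m → 2 * N ≤ M * (M + 1) → w ≠ 0 → σ w = μ • w →
      (∀ i, 1 ≤ i → i ≤ M → 2 * i < m → fourierSum m x (ω ^ i)⁻¹ w = 0) →
      ∃ v : W, v ≠ 0 ∧ σ v = ((ω ^ N)⁻¹ * μ) • v := by
  have hm0 : m ≠ 0 := by rintro rfl; simp at hc
  have hω0 : ω ≠ 0 := hω.ne_zero hm0
  have hpow : ∀ j : ℕ, (ω ^ j) ^ m = 1 := fun j => by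
    rw [← pow_mul, mul_comm, pow_mul, hω.pow_eq_one, one_pow]
  have hpow' : ∀ j : ℕ, ((ω ^ j)⁻¹) ^ m = 1 := fun j => by rw [inv_pow, hpow, inv_one]
  induction M with
  | zero =>
    intro N μ w _ hN hw0 hw _
    obtain rfl : N = 0 := by omega
    exact ⟨w, hw0, by simpa using hw⟩
  | succ M ih =>
    intro N μ w hM hN hw0 hw hkill
    by_cases hN' : 2 * N ≤ M * (M + 1)
    · exact ih N μ w (by omega) hN' hw0 hw fun i h1 h2 => hkill i h1 (by omega)
    have hNM : M + 1 ≤ N := by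
      rcases Nat.eq_zero_or_pos M with rfl | hpos
      · omega
      · nlinarith
    have hne : fourierSum m x (ω ^ (M + 1)) w ≠ 0 := by
      intro hz
      rcases lt_or_eq_of_le hM with h1 | h1
      · have h2 := h.fourierSum_apply_add (hpow' (M + 1)) (hpow (M + 1)) w
        rw [hz, hkill _ (by omega) le_rfl h1, map_zero, map_zero, add_zero,
          if_pos (inv_mul_cancel₀ (pow_ne_zero _ hω0))] at h2
        exact smul_ne_zero hc hw0 h2.symm
      · have h2 := h.fourierSum_apply_add (hpow (M + 1)) (hpow (M + 1)) w
        rw [hz, map_zero, add_zero, if_pos (by rw [← pow_add, ← two_mul, h1, hω.pow_eq_one])] at h2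
        exact smul_ne_zero hc hw0 h2.symm
    obtain ⟨v, hv0, hv⟩ := ih (N - (M + 1)) _ _ (by omega)
      (by zify [hNM]; zify at hN; linarith) hne
      (h.apply_fourierSum (pow_ne_zero _ hω0) (hpow _) hw) (by
        intro i h1 h2 h3
        have h4 := h.fourierSum_apply_add (hpow' i) (hpow (M + 1)) w
        have h5 : (ω ^ i)⁻¹ * ω ^ (M + 1) ≠ 1 := by
          intro h6
          have h7 := (inv_mul_eq_one₀ (pow_ne_zero _ hω0)).mp h6
          have := hω.pow_inj (by omega) (by omega) h7
          omega
        rwa [if_neg h5, zero_smul, hkill i h1 (by omega) h3, map_zero, add_zero] at h4)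
    refine ⟨v, hv0, ?_⟩
    rw [hv, ← mul_assoc, ← mul_inv, ← pow_add, Nat.sub_add_cancel hNM]

/-- If `m ∉ {3, 5}`, a representation in which `∑ σ ^ q` vanishes is zero. -/
theorem eq_zero_of_sum_pow_eq_zero [CharZero k] (h : CyclicClifford m c x σ) {ω : k}
    (hω : IsPrimitiveRoot ω m) (hc : c ≠ 0) (hm0 : m ≠ 0) (hm3 : m ≠ 3) (hm5 : m ≠ 5)
    (hsum : ∑ q ∈ range m, σ ^ q = 0) (w : W) : w = 0 := by
  by_contra hw
  have hmk : (m : k) ≠ 0 := Nat.cast_ne_zero.mpr hm0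
  obtain ⟨μ, v, hμ, hv0, hv⟩ := exists_eigenvector_of_pow_eq_one hmk hω h.pow_eq_one hw
  obtain ⟨ν, u, hν, hu0, hu, hkill⟩ := h.exists_vacuum hω hμ hv0 hv two_ne_zero (m / 2)
  have : NeZero m := ⟨hm0⟩
  obtain ⟨N, hN, rfl⟩ := hω.eq_pow_of_pow_eq_one hν
  have hbound : 2 * N ≤ m / 2 * (m / 2 + 1) := by
    rcases Nat.lt_or_ge m 8 with h8 | h8
    · interval_cases m <;> omega
    · have h4 : 4 ≤ m / 2 := by omega
      have : 4 * (m / 2 + 1) ≤ m / 2 * (m / 2 + 1) := Nat.mul_le_mul_right _ h4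
      omega
  obtain ⟨z, hz0, hz⟩ := h.exists_raised hω
    (mul_ne_zero hmk (mul_ne_zero two_ne_zero hc)) (m / 2) N _ u (Nat.mul_div_le m 2) hbound
    hu0 hu hkill
  rw [inv_mul_cancel₀ (pow_ne_zero _ (hω.ne_zero hm0)), one_smul] at hz
  have hpowz : ∀ q : ℕ, (σ ^ q) z = z := by
    intro q
    induction q with
    | zero => simp
    | succ q ih => rw [pow_succ, Module.End.mul_apply, hz, ih]
  have h1 := LinearMap.congr_fun hsum z
  simp only [LinearMap.sum_apply, hpowz, sum_const, card_range, LinearMap.zero_apply] at h1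
  rw [← Nat.cast_smul_eq_nsmul k] at h1
  exact smul_ne_zero hmk hz0 h1

end CyclicClifford

end Fermions

section Representation

variable {k : Type*} [Field k] {V : Type*} [AddCommGroup V] [Module k V] {n : ℕ}

/-- The joint eigenspace of the operators `X l * X l` with eigenvalues `t l`. -/
def jointEigenspace (X : ZMod n → Module.End k V) (t : ZMod n → k) : Submodule k V where
  carrier := {v | ∀ l, X l (X l v) = t l • v}
  add_mem' ha hb l := by simp [ha l, hb l]
  zero_mem' l := by simp
  smul_mem' c v hv l := by simp [hv l, smul_comm c]

/-- Operators on `V` defining a representation of the skew group algebra. -/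
structure SkewRep (X : ZMod n → Module.End k V) (S : Module.End k V) : Prop where
  anti : ∀ i j, i ≠ j → X i * X j + X j * X i = 0
  comm : ∀ i, S * X i = X (i + 1) * S
  pow_eq_one : S ^ n = 1

namespace SkewRep

variable {X : ZMod n → Module.End k V} {S : Module.End k V}

theorem anti_apply (h : SkewRep X S) {i j : ZMod n} (hij : i ≠ j) (v : V) :
    X i (X j v) = -X j (X i v) :=
  eq_neg_of_add_eq_zero_left (LinearMap.congr_fun (h.anti i j hij) v)

theorem pow_apply (h : SkewRep X S) (q : ℕ) (i : ZMod n) (v : V) :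
    (S ^ q) (X i v) = X (i + q) ((S ^ q) v) := by
  induction q generalizing i v with
  | zero => simp
  | succ q ih =>
    have h1 : S (X i v) = X (i + 1) (S v) := LinearMap.congr_fun (h.comm i) v
    simp only [pow_succ, Module.End.mul_apply, h1, ih, Nat.cast_succ]
    congr 2
    ring

theorem pow_mem (h : SkewRep X S) {t : ZMod n → k} {v : V} (hv : v ∈ jointEigenspace X t)
    (q : ℕ) : (S ^ q) v ∈ jointEigenspace X (fun l => t (l - q)) := by
  intro l
  have h1 := congrArg (S ^ q) (hv (l - q))
  simpa [h.pow_apply] using h1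

theorem apply_mem (h : SkewRep X S) {t : ZMod n → k} {v : V} (hv : v ∈ jointEigenspace X t)
    (j : ZMod n) : X j v ∈ jointEigenspace X t := by
  intro l
  by_cases hl : l = j
  · subst hl
    rw [hv l, map_smul]
  · rw [h.anti_apply hl, map_neg, h.anti_apply hl, neg_neg, hv l, map_smul]

/-- Restricting a vanishing sum over the orbit of `w` to the stabilizer of its eigenvalues. -/
theorem sum_filter_eq_zero (h : SkewRep X S) {t : ZMod n → k} {d : ℕ}
    (hd : ∀ i : ℕ, d ∣ i ↔ ∀ l, t (l - i) = t l)
    {w : V} (hw : w ∈ jointEigenspace X t) (hsum : ∑ i ∈ range n, (S ^ i) w = 0) :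
    ∑ i ∈ range n with d ∣ i, (S ^ i) w = 0 := by
  have key : ∀ B : Finset ℕ, ∃ (c : ℕ → k) (c₀ : k), c₀ ≠ 0 ∧
      ∑ i ∈ range n, c i • (S ^ i) w = 0 ∧ (∀ i ∈ B, ¬ d ∣ i → c i = 0) ∧
      ∀ i, d ∣ i → c i = c₀ := by
    intro B
    induction B using Finset.induction_on with
    | empty => exact ⟨fun _ => 1, 1, one_ne_zero, by simpa using hsum, by simp, fun _ _ => rfl⟩
    | insert j B _ ih =>
      obtain ⟨c, c₀, hc₀, hc, hB, hcd⟩ := ih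
      by_cases hj : d ∣ j
      · refine ⟨c, c₀, hc₀, hc, fun i hi hdi => ?_, hcd⟩
        rcases Finset.mem_insert.mp hi with rfl | hi
        · exact absurd hj hdi
        · exact hB i hi hdi
      obtain ⟨l, hl⟩ := not_forall.mp (mt (hd j).mpr hj)
      refine ⟨fun i => c i * (t (l - i) - t (l - j)), c₀ * (t l - t (l - j)),
        mul_ne_zero hc₀ (sub_ne_zero.mpr (Ne.symm hl)), ?_, fun i hi hdi => ?_, fun i hi => ?_⟩
      · have h1 := congrArg (fun u => X l (X l u) - t (l - j) • u) hc
        simp only [map_sum, map_smul, map_zero, smul_zero, sub_zero, smul_sum,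
          ← sum_sub_distrib] at h1
        rw [← h1]
        refine sum_congr rfl fun i _ => ?_
        rw [h.pow_mem hw i l, smul_smul, smul_smul, ← sub_smul]
        congr 1
        ring
      · rcases Finset.mem_insert.mp hi with rfl | hi
        · simp
        · simp [hB i hi hdi]
      · simp only [hcd i hi, (hd i).mp hi l]
  obtain ⟨c, c₀, hc₀, hc, hB, hcd⟩ := key (range n)
  have h2 : c₀ • ∑ i ∈ range n with d ∣ i, (S ^ i) w = 0 := by
    rw [← hc, smul_sum, sum_filter]
    refine sum_congr rfl fun i hi => ?_
    split_ifs with hdi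
    · rw [hcd i hdi]
    · rw [hB i hi hdi, zero_smul]
  exact (smul_eq_zero.mp h2).resolve_left hc₀

end SkewRep

/-- The stabilizer of a function on `ZMod n` under translation is generated by some `d ∣ n`. -/
theorem exists_period [NeZero n] {α : Type*} (t : ZMod n → α) :
    ∃ d : ℕ, d ∣ n ∧ ∀ i : ℕ, d ∣ i ↔ ∀ l, t (l - i) = t l := by
  let H : AddSubgroup ℤ :=
    { carrier := {i | ∀ l, t (l - (i : ZMod n)) = t l}
      zero_mem' := by simp
      add_mem' := by
        intro a b ha hb l
        rw [Int.cast_add, ← sub_sub, hb, ha]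
      neg_mem' := by
        intro a ha l
        rw [← ha (l - ((-a : ℤ) : ZMod n))]
        simp }
  obtain ⟨g, hg⟩ := Int.subgroup_cyclic H
  have hH : ∀ i : ℕ, g.natAbs ∣ i ↔ ∀ l, t (l - i) = t l := by
    intro i
    have h1 : (i : ℤ) ∈ H ↔ g ∣ i := by
      rw [hg, ← AddSubgroup.zmultiples_eq_closure, Int.mem_zmultiples_iff]
    rw [← Int.natCast_dvd_natCast, Int.natAbs_dvd, ← h1]
    change (∀ l, t (l - ((i : ℤ) : ZMod n)) = t l) ↔ _
    simp
  exact ⟨g.natAbs, (hH n).mpr (by simp), hH⟩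

/-- If `3` and `5` do not divide `n`, a representation of the skew group algebra without
invariants has no joint eigenvector for a nonzero system of eigenvalues. -/
theorem SkewRep.eq_zero_of_mem_jointEigenspace [IsAlgClosed k] [CharZero k] [NeZero n]
    {X : ZMod n → Module.End k V} {S : Module.End k V} (h : SkewRep X S)
    (hsum : ∑ i ∈ range n, S ^ i = 0) (h3 : ¬ 3 ∣ n) (h5 : ¬ 5 ∣ n) {t : ZMod n → k}
    {l₀ : ZMod n} (hl₀ : t l₀ ≠ 0) {v : V} (hv : v ∈ jointEigenspace X t) : v = 0 := by
  obtain ⟨d, ⟨m, hm⟩, hd⟩ := exists_period t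
  have hn0 : n ≠ 0 := NeZero.ne n
  have hd0 : 0 < d := Nat.pos_of_ne_zero (by rintro rfl; simp_all)
  have hm0 : m ≠ 0 := by rintro rfl; simp_all
  have : NeZero (m : k) := ⟨Nat.cast_ne_zero.mpr hm0⟩
  obtain ⟨ω, hω⟩ := HasEnoughRootsOfUnity.exists_primitiveRoot k m
  have hσ : ∀ w ∈ jointEigenspace X t, (S ^ d) w ∈ jointEigenspace X t := fun w hw => by
    have h1 := h.pow_mem hw d
    rwa [funext ((hd d).mp dvd_rfl)] at h1
  have ht : ∀ q : ℕ, t (l₀ + (d * q : ℕ)) = t l₀ := fun q => by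
    have h1 := (hd (d * q)).mp ⟨q, rfl⟩ (l₀ + (d * q : ℕ))
    rwa [add_sub_cancel_right, eq_comm] at h1
  let σ : Module.End k (jointEigenspace X t) := (S ^ d).restrict hσ
  let x : ℕ → Module.End k (jointEigenspace X t) := fun q =>
    (X (l₀ + (d * q : ℕ))).restrict fun w hw => h.apply_mem hw _
  have hσq : ∀ (q : ℕ) (w : jointEigenspace X t), ((σ ^ q) w : V) = (S ^ (d * q)) w := by
    intro q w
    induction q with
    | zero => simp
    | succ q ih =>
      rw [pow_succ', Module.End.mul_apply, LinearMap.coe_restrict_apply, ih, Nat.mul_succ,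
        add_comm, pow_add, Module.End.mul_apply]
  have hcl : CyclicClifford m (t l₀) x σ := by
    refine ⟨fun i => ?_, fun i hi j hj hij => ?_, ?_, fun i => ?_, ?_⟩
    · ext w
      have h1 := w.2 (l₀ + (d * i : ℕ))
      rw [ht] at h1
      simpa [x] using h1
    · ext w
      have hne : l₀ + ((d * i : ℕ) : ZMod n) ≠ l₀ + (d * j : ℕ) := by
        intro h1
        have h2 := (ZMod.natCast_eq_natCast_iff' _ _ _).mp (add_left_cancel h1)
        rw [Nat.mod_eq_of_lt (hm ▸ Nat.mul_lt_mul_of_pos_left hi hd0),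
          Nat.mod_eq_of_lt (hm ▸ Nat.mul_lt_mul_of_pos_left hj hd0)] at h2
        exact hij (Nat.eq_of_mul_eq_mul_left hd0 h2)
      exact LinearMap.congr_fun (h.anti _ _ hne) w.1
    · simp only [x, ← hm]
      simp
    · ext w
      have h1 := h.pow_apply d (l₀ + (d * i : ℕ)) w
      rw [add_assoc, ← Nat.cast_add, ← Nat.mul_succ] at h1
      exact h1
    · ext w
      rw [hσq, ← hm, h.pow_eq_one]
      simp
  have hsum' : ∑ q ∈ range m, σ ^ q = 0 := by
    ext w
    have h1 := h.sum_filter_eq_zero hd w.2 (by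
      simpa using LinearMap.congr_fun hsum w.1)
    have h2 : {i ∈ range n | d ∣ i} = (range m).image (d * ·) := by
      ext i
      simp only [mem_filter, mem_range, mem_image]
      constructor
      · rintro ⟨hi, q, rfl⟩
        exact ⟨q, Nat.lt_of_mul_lt_mul_left (hm ▸ hi), rfl⟩
      · rintro ⟨q, hq, rfl⟩
        exact ⟨hm ▸ Nat.mul_lt_mul_of_pos_left hq hd0, q, rfl⟩
    rw [h2, sum_image fun a _ b _ hab => Nat.eq_of_mul_eq_mul_left hd0 hab] at h1
    simpa [hσq] using h1
  have hm3 : m ≠ 3 := by rintro rfl; exact h3 ⟨d, by rw [hm, mul_comm]⟩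
  have hm5 : m ≠ 5 := by rintro rfl; exact h5 ⟨d, by rw [hm, mul_comm]⟩
  exact congrArg Subtype.val
    (hcl.eq_zero_of_sum_pow_eq_zero hω hl₀ hm0 hm3 hm5 hsum' ⟨v, hv⟩)

end Representation

section Finiteness

open scoped IsMulCommutative

variable {k : Type*} [Field k] {E : Type*} [Ring E] [Algebra k E]

/-- A non-nilpotent element of a commutative subalgebra `R` over which `E` is finite does not
vanish at some `k`-point of `R` at which the fibre of `E` is nonzero. -/
theorem exists_point_of_not_isNilpotent [IsAlgClosed k] (R : Subalgebra k E)
    [IsMulCommutative R] [Algebra.FiniteType k R] [Module.Finite R E] {y : R}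
    (hy : ¬ IsNilpotent y) :
    ∃ (t : R →ₐ[k] k) (J : Submodule k E), t y ≠ 0 ∧ (1 : E) ∉ J ∧
      (∀ e ∈ J, ∀ a : E, e * a ∈ J) ∧ ∀ r : R, (r : E) - t r • (1 : E) ∈ J := by
  have : IsJacobsonRing R := isJacobsonRing_of_finiteType (A := k)
  have h1 : y ∉ (⊥ : Ideal R).jacobson := by
    rw [← Ideal.radical_eq_jacobson]
    exact fun h => hy (mem_nilradical.mp h)
  obtain ⟨M, ⟨-, hM⟩, hyM⟩ : ∃ M : Ideal R, (⊥ ≤ M ∧ M.IsMaximal) ∧ y ∉ M := by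
    by_contra! h
    exact h1 (Ideal.mem_sInf.mpr fun {I} hI => h I hI)
  let : Field (R ⧸ M) := Ideal.Quotient.field M
  have : Algebra.FiniteType k (R ⧸ M) :=
    Algebra.FiniteType.of_surjective (Ideal.Quotient.mkₐ k M) (Ideal.Quotient.mkₐ_surjective k M)
  have : Module.Finite k (R ⧸ M) := finite_of_finite_type_of_isJacobsonRing k _
  let φ : k ≃ₐ[k] (R ⧸ M) := AlgEquiv.ofBijective (Algebra.ofId k (R ⧸ M))
    IsAlgClosed.algebraMap_bijective_of_isIntegral
  let t : R →ₐ[k] k := φ.symm.toAlgHom.comp (Ideal.Quotient.mkₐ k M)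
  have ht : ∀ r : R, t r = 0 ↔ r ∈ M := fun r => by
    simp [t, Ideal.Quotient.eq_zero_iff_mem]
  have hmul : ∀ e ∈ M • (⊤ : Submodule R E), ∀ a : E, e * a ∈ M • (⊤ : Submodule R E) := by
    intro e he a
    induction he using Submodule.smul_induction_on' with
    | smul r hr u _ =>
      rw [smul_mul_assoc]
      exact Submodule.smul_mem_smul hr trivial
    | add u _ v _ hu hv =>
      rw [add_mul]
      exact add_mem hu hv
  refine ⟨t, (M • (⊤ : Submodule R E)).restrictScalars k, mt (ht y).mp hyM, ?_, hmul, ?_⟩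
  · intro hmem
    have htop : (⊤ : Submodule R E) ≤ M • ⊤ := fun e _ => by
      simpa using hmul 1 hmem e
    obtain ⟨r, hr, hr0⟩ := Submodule.exists_sub_one_mem_and_smul_eq_zero_of_fg_of_le_smul M
      (⊤ : Submodule R E) Module.Finite.fg_top htop
    have h0 : r = 0 := Subtype.ext (by simpa [Subalgebra.smul_def] using hr0 1 trivial)
    rw [h0, zero_sub, neg_mem_iff] at hr
    exact hM.ne_top ((Ideal.eq_top_iff_one M).mpr hr)
  · intro r
    have h2 : r - algebraMap k R (t r) ∈ M := by
      rw [← ht, map_sub, AlgHom.commutes, Algebra.algebraMap_self_apply, sub_self]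
    have h3 : (r - algebraMap k R (t r)) • (1 : E) ∈ M • (⊤ : Submodule R E) :=
      Submodule.smul_mem_smul h2 trivial
    simpa [Subalgebra.smul_def, Algebra.algebraMap_eq_smul_one] using h3

variable {n : ℕ} {x : ZMod n → E} {s : E}

theorem list_prod_mul_of_notMem (hanti : ∀ i j, i ≠ j → x i * x j + x j * x i = 0)
    {l : ZMod n} {L : List (ZMod n)} (hl : l ∉ L) :
    (L.map x).prod * x l = (-1) ^ L.length * (x l * (L.map x).prod) := by
  induction L with
  | nil => simp
  | cons a L ih =>
    rw [List.mem_cons, not_or] at hl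
    have h1 : x a * x l = -(x l * x a) := eq_neg_of_add_eq_zero_left (hanti a l (Ne.symm hl.1))
    have h2 : Commute (x a) ((-1) ^ L.length) := (Commute.neg_one_right _).pow_right _
    simp only [List.map_cons, List.prod_cons, List.length_cons]
    rw [mul_assoc, ih hl.2, ← mul_assoc (x a), h2.eq, mul_assoc, ← mul_assoc (x a), h1, pow_succ]
    noncomm_ring

theorem sq_commute (hanti : ∀ i j, i ≠ j → x i * x j + x j * x i = 0) (i j : ZMod n) :
    Commute (x i * x i) (x j) := by
  by_cases h : i = j
  · subst h
    exact (Commute.refl _).mul_left (Commute.refl _)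
  · have h1 : x i * x j = -(x j * x i) := eq_neg_of_add_eq_zero_left (hanti i j h)
    rw [commute_iff_eq, mul_assoc, h1, mul_neg, ← mul_assoc, h1, neg_mul, neg_neg, mul_assoc]

theorem pow_mul_gen (hcomm : ∀ i, s * x i = x (i + 1) * s) (q : ℕ) (i : ZMod n) :
    s ^ q * x i = x (i + q) * s ^ q := by
  induction q generalizing i with
  | zero => simp
  | succ q ih =>
    rw [pow_succ, mul_assoc, hcomm, ← mul_assoc, ih, mul_assoc, Nat.cast_succ, add_assoc,
      add_comm 1]

/-- `E` is finite over the subalgebra generated by the squares of the `x i`. -/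
theorem finite_over_adjoin_sq [NeZero n]
    (hanti : ∀ i j, i ≠ j → x i * x j + x j * x i = 0) (hcomm : ∀ i, s * x i = x (i + 1) * s)
    (hpow : s ^ n = 1) (hgen : Algebra.adjoin k (insert s (Set.range x)) = ⊤) :
    Module.Finite (Algebra.adjoin k (Set.range fun l => x l * x l)) E := by
  set R := Algebra.adjoin k (Set.range fun l => x l * x l)
  let f : {L : List (ZMod n) // L.Nodup} × Fin n → E := fun p => (p.1.1.map x).prod * s ^ p.2.1
  let N : Submodule R E := Submodule.span R (Set.range f)
  have hfN : ∀ L : List (ZMod n), L.Nodup → ∀ j : ℕ, (L.map x).prod * s ^ j ∈ N := by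
    intro L hL j
    have h1 : s ^ j = s ^ (j % n) := by
      conv_lhs => rw [← Nat.div_add_mod j n, pow_add, pow_mul, hpow, one_pow, one_mul]
    rw [h1]
    exact Submodule.subset_span ⟨(⟨L, hL⟩, ⟨j % n, Nat.mod_lt _ (NeZero.pos n)⟩), rfl⟩
  have hN : ∀ g ∈ insert s (Set.range x), ∀ u ∈ N, u * g ∈ N := by
    intro g hg u hu
    induction hu using Submodule.span_induction with
    | zero => simp
    | add a b _ _ ha hb => rw [add_mul]; exact N.add_mem ha hb
    | smul r a _ ha => rw [smul_mul_assoc]; exact N.smul_mem r ha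
    | mem u hu =>
      obtain ⟨⟨⟨L, hL⟩, j⟩, rfl⟩ := hu
      rcases hg with rfl | ⟨l, rfl⟩
      · simp only [f, mul_assoc, ← pow_succ]
        exact hfN L hL _
      · simp only [f]
        rw [mul_assoc, pow_mul_gen hcomm]
        generalize l + ((j : ℕ) : ZMod n) = i
        by_cases hi : i ∈ L
        · obtain ⟨L₁, L₂, rfl⟩ := List.append_of_mem hi
          have hL' := List.nodup_middle.mp hL
          have hi₁ : i ∉ L₁ ++ L₂ := (List.nodup_cons.mp hL').1
          have hnd : (L₁ ++ L₂).Nodup := (List.nodup_cons.mp hL').2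
          rw [List.mem_append, not_or] at hi₁
          have h1 : ((L₁ ++ i :: L₂).map x).prod * (x i * s ^ (j : ℕ)) =
              (-1) ^ L₂.length * (x i * x i * (((L₁ ++ L₂).map x).prod * s ^ (j : ℕ))) := by
            have h2 : Commute (x i * x i) (L₁.map x).prod := by
              refine Commute.list_prod_right _ _ fun b hb => ?_
              obtain ⟨l, -, rfl⟩ := List.mem_map.mp hb
              exact sq_commute hanti i l
            have h3 : (L₂.map x).prod * x i = (-1) ^ L₂.length * (x i * (L₂.map x).prod) :=
              list_prod_mul_of_notMem hanti hi₁.2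
            have h4 : ((L₁ ++ i :: L₂).map x).prod * (x i * s ^ (j : ℕ)) =
                (L₁.map x).prod * x i * ((L₂.map x).prod * x i) * s ^ (j : ℕ) := by
              simp [mul_assoc]
            have h5 : ((L₁ ++ L₂).map x).prod = (L₁.map x).prod * (L₂.map x).prod := by simp
            rw [h4, h3, h5, ← mul_assoc (x i * x i), ← mul_assoc (x i * x i), h2.eq]
            rcases neg_one_pow_eq_or E L₂.length with h | h <;> rw [h] <;> noncomm_ring
          rw [h1]
          have h2 : (⟨x i * x i, Algebra.subset_adjoin ⟨i, rfl⟩⟩ : R) •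
              (((L₁ ++ L₂).map x).prod * s ^ (j : ℕ)) ∈ N := N.smul_mem _ (hfN _ hnd _)
          rcases neg_one_pow_eq_or E L₂.length with h | h <;> rw [h]
          · rw [one_mul]; exact h2
          · rw [neg_one_mul]; exact N.neg_mem h2
        · rw [← mul_assoc, list_prod_mul_of_notMem hanti hi, mul_assoc]
          have h2 := hfN (i :: L) (List.nodup_cons.mpr ⟨hi, hL⟩) j
          rw [List.map_cons, List.prod_cons] at h2
          rcases neg_one_pow_eq_or E L.length with h | h <;> rw [h]
          · rw [one_mul]; exact h2
          · rw [neg_one_mul]; exact N.neg_mem h2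
  have hall : ∀ e : E, ∀ u ∈ N, u * e ∈ N := by
    intro e
    have he : e ∈ Algebra.adjoin k (insert s (Set.range x)) := hgen ▸ trivial
    induction he using Algebra.adjoin_induction with
    | mem g hg => exact hN g hg
    | algebraMap c =>
      intro u hu
      rw [← Algebra.commutes, ← Algebra.smul_def]
      exact N.smul_of_tower_mem c hu
    | add a b _ _ ha hb => intro u hu; rw [mul_add]; exact N.add_mem (ha u hu) (hb u hu)
    | mul a b _ _ ha hb => intro u hu; rw [← mul_assoc]; exact hb _ (ha u hu)
  have hone : (1 : E) ∈ N := by simpa using hfN [] List.nodup_nil 0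
  have htop : N = ⊤ := eq_top_iff.mpr fun e _ => by simpa using hall e 1 hone
  exact ⟨htop ▸ Submodule.fg_span (Set.finite_range f)⟩

/-- An algebra generated by a representation of the skew group algebra without invariants is
finite-dimensional if `3` and `5` do not divide `n`. -/
theorem finiteDimensional_of_sum_pow_eq_zero [IsAlgClosed k] [CharZero k] [NeZero n]
    (h3 : ¬ 3 ∣ n) (h5 : ¬ 5 ∣ n)
    (hanti : ∀ i j, i ≠ j → x i * x j + x j * x i = 0) (hcomm : ∀ i, s * x i = x (i + 1) * s)
    (hpow : s ^ n = 1) (hsum : ∑ i ∈ range n, s ^ i = 0)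
    (hgen : Algebra.adjoin k (insert s (Set.range x)) = ⊤) : FiniteDimensional k E := by
  have hsq : ∀ a ∈ Set.range (fun l => x l * x l), ∀ b ∈ Set.range (fun l => x l * x l),
      a * b = b * a := by
    rintro _ ⟨i, rfl⟩ _ ⟨j, rfl⟩
    exact ((sq_commute hanti i j).mul_right (sq_commute hanti i j)).eq
  have hfin := finite_over_adjoin_sq (k := k) hanti hcomm hpow hgen
  have : IsMulCommutative (Algebra.adjoin k (Set.range fun l => x l * x l)) :=
    Algebra.isMulCommutative_adjoin k hsq
  set R := Algebra.adjoin k (Set.range fun l => x l * x l)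
  have hft : Algebra.FiniteType k R :=
    (Subalgebra.fg_iff_finiteType _).mp
      (Subalgebra.fg_def.mpr ⟨_, Set.finite_range _, rfl⟩)
  let y : ZMod n → R := fun l => ⟨x l * x l, Algebra.subset_adjoin ⟨l, rfl⟩⟩
  have hnil : ∀ l, IsNilpotent (y l) := by
    intro l₀
    by_contra hl₀
    obtain ⟨t, J, ht, hJ1, hJ, hJt⟩ := exists_point_of_not_isNilpotent R hl₀
    let ρ : E → Module.End k (E ⧸ J) := fun a =>
      J.mapQ J (LinearMap.mulRight k a) fun e he => hJ e he a
    have hρ : ∀ a e, ρ a (J.mkQ e) = J.mkQ (e * a) := fun a e => rfl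
    have hρmul : ∀ a b, ρ a * ρ b = ρ (b * a) := fun a b => by
      ext e
      exact congrArg J.mkQ (mul_assoc e b a)
    have hρadd : ∀ a b, ρ a + ρ b = ρ (a + b) := fun a b => by
      ext e
      exact congrArg J.mkQ (mul_add e a b).symm
    have hρone : ρ 1 = 1 := by
      ext e
      simp [ρ]
    have hρzero : ρ 0 = 0 := by
      ext e
      simp [ρ]
    have hρpow : ∀ i : ℕ, ρ s ^ i = ρ (s ^ i) := by
      intro i
      induction i with
      | zero => simp [hρone]
      | succ i ih => rw [pow_succ, ih, hρmul, pow_succ']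
    have hrep : SkewRep (fun i => ρ (x (-i))) (ρ s) := by
      refine ⟨fun i j hij => ?_, fun i => ?_, ?_⟩
      · rw [hρmul, hρmul, hρadd, hanti _ _ (by simpa using hij.symm), hρzero]
      · rw [hρmul, hρmul, hcomm]
        congr 3
        ring
      · rw [hρpow, hpow, hρone]
    have hsumρ : ∑ i ∈ range n, ρ s ^ i = 0 := by
      ext e
      simp only [hρpow, LinearMap.comp_apply, LinearMap.sum_apply, hρ]
      rw [← map_sum, ← mul_sum, hsum, mul_zero, map_zero, LinearMap.zero_apply]
    have hv : J.mkQ 1 ∈ jointEigenspace (fun i => ρ (x (-i))) (fun i => t (y (-i))) := by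
      intro l
      rw [hρ, hρ, one_mul, ← map_smul, ← sub_eq_zero, ← map_sub, Submodule.mkQ_apply,
        Submodule.Quotient.mk_eq_zero]
      exact hJt (y (-l))
    have h0 := hrep.eq_zero_of_mem_jointEigenspace hsumρ h3 h5 (l₀ := -l₀)
      (by simpa using ht) hv
    exact hJ1 (by simpa using h0)
  have : Algebra.IsIntegral k R := by
    refine ⟨fun ⟨e, he⟩ => ?_⟩
    induction he using Algebra.adjoin_induction with
    | mem e he =>
      obtain ⟨l, rfl⟩ := he
      obtain ⟨N, hN⟩ := hnil l
      refine IsIntegral.of_pow (Nat.succ_pos N) ?_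
      change IsIntegral k (y l ^ (N + 1))
      rw [pow_succ, hN, zero_mul]
      exact isIntegral_zero
    | algebraMap c => exact isIntegral_algebraMap (R := k) (A := R) (x := c)
    | add a b _ _ ha hb => exact ha.add hb
    | mul a b _ _ ha hb => exact ha.mul hb
  have : Module.Finite k R := Algebra.IsIntegral.finite
  exact Module.Finite.trans R E

end Finiteness

end NCIS

open NCIS in
/-- Theorem 0.2: if `n = 2^a p^b` for a prime `p ≥ 7` and integers
`a, b ≥ 0`, with `n ≥ 2`, then `E = (A#C_n)/(e₀)` is finite-dimensional over `k`. -/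
theorem skewGroup_quotient_finiteDimensional_of_eq_two_pow_mul_prime_pow
    (k : Type*) [Field k] [IsAlgClosed k] [CharZero k]
    (n a b p : ℕ) (hp : p.Prime) (hp7 : 7 ≤ p) (hn : n = 2 ^ a * p ^ b) (hn2 : 2 ≤ n) :
    FiniteDimensional k (Equot k n) := by
  have : NeZero n := ⟨by omega⟩
  have hdvd : ∀ q : ℕ, q.Prime → q ∣ n → q = 2 ∨ q = p := by
    intro q hq h
    rw [hn, hq.dvd_mul] at h
    exact h.imp (fun h => (Nat.prime_dvd_prime_iff_eq hq Nat.prime_two).mp (hq.dvd_of_dvd_pow h))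
      fun h => (Nat.prime_dvd_prime_iff_eq hq hp).mp (hq.dvd_of_dvd_pow h)
  let π : SkewGroup k n →ₐ[k] Equot k n := RingQuot.mkAlgHom k _
  let θ : FreeAlgebra k (ZMod n ⊕ Unit) →ₐ[k] Equot k n :=
    π.comp (RingQuot.mkAlgHom k (SGRel k n))
  have hθ : Function.Surjective θ :=
    (RingQuot.mkAlgHom_surjective k _).comp (RingQuot.mkAlgHom_surjective k _)
  have hrel : ∀ {u v}, SGRel k n u v → θ u = θ v := fun h =>
    congrArg π (RingQuot.mkAlgHom_rel k h)
  refine finiteDimensional_of_sum_pow_eq_zero (x := fun i => θ (FreeAlgebra.ι k (Sum.inl i)))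
    (s := θ (FreeAlgebra.ι k (Sum.inr ())))
    (fun h => by have := hdvd 3 Nat.prime_three h; omega)
    (fun h => by have := hdvd 5 Nat.prime_five h; omega) ?_ ?_ ?_ ?_ ?_
  · intro i j hij
    simpa using hrel (SGRel.anti i j hij)
  · intro i
    simpa using hrel (SGRel.scomm i)
  · simpa using hrel SGRel.spow
  · have h1 : π (e0 k n) = 0 := by
      have := RingQuot.mkAlgHom_rel k
        (s := fun a b : SkewGroup k n => a = e0 k n ∧ b = 0) ⟨rfl, rfl⟩
      rwa [map_zero] at this
    have h2 : π ((n : k)⁻¹ • ∑ i ∈ Finset.range n, sg k n ^ i) = 0 := h1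
    rw [map_smul, map_sum] at h2
    simp only [map_pow] at h2
    exact (smul_eq_zero.mp h2).resolve_left (inv_ne_zero (NeZero.ne (n : k)))
  · have h1 := congrArg (Subalgebra.map θ) (FreeAlgebra.adjoin_range_ι k (ZMod n ⊕ Unit))
    rw [Algebra.map_top, (AlgHom.range_eq_top θ).mpr hθ, AlgHom.map_adjoin] at h1
    rw [← h1]
    congr 1
    ext e
    simp only [← Set.range_comp, Set.mem_insert_iff, Set.mem_range, Function.comp_apply, Sum.exists]
    simp only [eq_comm (a := e), or_comm (b := ∃ y : Unit, _)]
    exact or_congr_left ⟨fun h => ⟨(), h⟩, fun ⟨_, h⟩ => h⟩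
end

section
/- If n ≥ 2 is divisible by 3 or by 5, then the quotient algebra E = (A#C_n)/(e₀) is infinite-dimensional as a k-vector space (equivalently, GKdim E ≥ 1, i.e. the pertinency p(A, C_n) is strictly less than n). -/
open scoped BigOperators

namespace NCIS

/-- A cyclic Clifford datum of order `p`: an operator `S` of order `p` without invariants whose
conjugates of the involution `X` anticommute with `X`. -/
structure CyclicClifford_s1 {B : Type*} [Ring B] (p : ℕ) (S X : B) : Prop where
  pow_eq_one : S ^ p = 1
  sum_pow : ∑ i ∈ Finset.range p, S ^ i = 0
  sq_eq_one : X * X = 1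
  anticomm : ∀ d, 0 < d → d < p →
    X * (S ^ d * X * S ^ (p - d)) + S ^ d * X * S ^ (p - d) * X = 0

theorem cyclicClifford_three {k : Type*} [Field k] (I : k) (hI : I * I = -1) :
    CyclicClifford_s1 3 (!![0, -1; 1, -1] : Matrix (Fin 2) (Fin 2) k) !![1, 0; 1 - I, -1] where
  pow_eq_one := by
    simp [pow_succ, Matrix.one_fin_two]
  sum_pow := by
    ext i j
    fin_cases i <;> fin_cases j <;> simp [Finset.sum_range_succ, pow_succ, Matrix.one_fin_two]
  sq_eq_one := by
    simp [Matrix.one_fin_two]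
  anticomm d hd hd' := by
    ext i j
    interval_cases d <;> fin_cases i <;> fin_cases j <;> simp [pow_succ] <;> grind

set_option maxHeartbeats 1000000 in
theorem cyclicClifford_five {k : Type*} [Field k] (I : k) (hI : I * I = -1) :
    CyclicClifford_s1 5
      (!![0, 0, 0, -1; 1, 0, 0, -1; 0, 1, 0, -1; 0, 0, 1, -1] : Matrix (Fin 4) (Fin 4) k)
      !![-I, 0, I - 1, 0; 0, 1, 0, -1 - I; -1 - I, 0, I, 0; 0, 0, 0, -1] where
  pow_eq_one := by
    ext i j
    fin_cases i <;> fin_cases j <;> simp [pow_succ, Matrix.mul_apply, Fin.sum_univ_four]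
  sum_pow := by
    ext i j
    fin_cases i <;> fin_cases j <;>
      simp [Finset.sum_range_succ, pow_succ]
  sq_eq_one := by
    ext i j
    fin_cases i <;> fin_cases j <;> simp [Matrix.mul_apply, Fin.sum_univ_four] <;> grind
  anticomm d hd hd' := by
    have h₂ : (!![0, 0, 0, -1; 1, 0, 0, -1; 0, 1, 0, -1; 0, 0, 1, -1] :
        Matrix (Fin 4) (Fin 4) k) ^ 2 =
        !![0, 0, -1, 1; 0, 0, -1, 0; 1, 0, -1, 0; 0, 1, -1, 0] := by
      simp [sq]
    have h₃ : (!![0, 0, 0, -1; 1, 0, 0, -1; 0, 1, 0, -1; 0, 0, 1, -1] :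
        Matrix (Fin 4) (Fin 4) k) ^ 3 =
        !![0, -1, 1, 0; 0, -1, 0, 1; 0, -1, 0, 0; 1, -1, 0, 0] := by
      rw [pow_succ, h₂]
      simp
    have h₄ : (!![0, 0, 0, -1; 1, 0, 0, -1; 0, 1, 0, -1; 0, 0, 1, -1] :
        Matrix (Fin 4) (Fin 4) k) ^ 4 =
        !![-1, 1, 0, 0; -1, 0, 1, 0; -1, 0, 0, 1; -1, 0, 0, 0] := by
      rw [pow_succ, h₃]
      simp
    interval_cases d <;> simp [h₂, h₃, h₄] <;> ext i j <;>
      fin_cases i <;> fin_cases j <;> simp <;> grind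

section Index

variable {B : Type*} [Ring B] (n m : ℕ) (S : B)

/-- The function on `ZMod n` sending `i * m` to `S ^ i` and vanishing off the multiples of `m`. -/
def powSupp (a : ZMod n) : B := if m ∣ a.val then S ^ (a.val / m) else 0

variable {n m S} {p : ℕ}

theorem powSupp_of_not_dvd {a : ZMod n} (h : ¬ m ∣ a.val) : powSupp n m S a = 0 := if_neg h

theorem powSupp_natCast_mul (hn : n = p * m) (hm : 0 < m) (hS : S ^ p = 1) (i : ℕ) :
    powSupp n m S ((i * m : ℕ) : ZMod n) = S ^ i := by
  have hval : (((i * m : ℕ) : ZMod n)).val = (i % p) * m := by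
    rw [ZMod.val_natCast, hn, Nat.mul_mod_mul_right]
  rw [powSupp, hval, if_pos (Dvd.intro_left _ rfl), Nat.mul_div_cancel _ hm]
  conv_rhs => rw [← Nat.mod_add_div i p, pow_add, pow_mul, hS, one_pow, mul_one]

theorem exists_eq_natCast_mul [NeZero n] (hn : n = p * m) {a : ZMod n} (h : m ∣ a.val) :
    ∃ i < p, a = ((i * m : ℕ) : ZMod n) := by
  obtain ⟨i, hi⟩ := h
  refine ⟨i, ?_, ?_⟩
  · have := a.val_lt
    rw [hi, hn, mul_comm] at this
    exact lt_of_mul_lt_mul_right this (Nat.zero_le m)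
  · rw [mul_comm, ← hi, ZMod.natCast_zmod_val]

theorem dvd_val_add_iff [NeZero n] (hn : n = p * m) (a : ZMod n) :
    m ∣ (a + (m : ZMod n)).val ↔ m ∣ a.val := by
  have hmn : m ∣ n := hn ▸ Dvd.intro_left _ rfl
  rw [ZMod.val_add, ZMod.val_natCast, Nat.add_mod_mod, Nat.dvd_mod_iff hmn, Nat.dvd_add_self_right]

theorem powSupp_add [NeZero n] (hn : n = p * m) (hm : 0 < m) (hS : S ^ p = 1) (a : ZMod n) :
    powSupp n m S (a + m) = S * powSupp n m S a := by
  by_cases h : m ∣ a.val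
  · obtain ⟨i, -, rfl⟩ := exists_eq_natCast_mul hn h
    have : ((i * m : ℕ) : ZMod n) + m = (((i + 1) * m : ℕ) : ZMod n) := by push_cast; ring
    rw [this, powSupp_natCast_mul hn hm hS, powSupp_natCast_mul hn hm hS, pow_succ']
  · rw [powSupp_of_not_dvd h, powSupp_of_not_dvd (by rwa [dvd_val_add_iff hn]), mul_zero]

variable (n m S) in
/-- The function on `ZMod n` sending `i * m` to `S ^ i * X * S ^ (-i)` and vanishing off the
multiples of `m`. -/
def conjSupp (X : B) (a : ZMod n) : B := powSupp n m S a * X * powSupp n m S (-a)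

variable {X : B}

theorem conjSupp_of_not_dvd {a : ZMod n} (h : ¬ m ∣ a.val) : conjSupp n m S X a = 0 := by
  rw [conjSupp, powSupp_of_not_dvd h, zero_mul, zero_mul]

theorem conjSupp_natCast_mul (hn : n = p * m) (hm : 0 < m) (hS : S ^ p = 1) {i : ℕ}
    (hi : i ≤ p) : conjSupp n m S X ((i * m : ℕ) : ZMod n) = S ^ i * X * S ^ (p - i) := by
  have : -((i * m : ℕ) : ZMod n) = (((p - i) * m : ℕ) : ZMod n) := by
    rw [neg_eq_iff_add_eq_zero, ← Nat.cast_add, ← add_mul, Nat.add_sub_cancel' hi, ← hn,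
      ZMod.natCast_self]
  rw [conjSupp, this, powSupp_natCast_mul hn hm hS, powSupp_natCast_mul hn hm hS]

theorem conjSupp_add_mul [NeZero n] (hn : n = p * m) (hm : 0 < m) (hS : S ^ p = 1)
    (a : ZMod n) : conjSupp n m S X (a + m) * S = S * conjSupp n m S X a := by
  have h := powSupp_add hn hm hS (-(a + m))
  rw [neg_add, neg_add_cancel_right] at h
  have hcomm (b : ZMod n) : Commute S (powSupp n m S b) := by
    unfold powSupp
    split_ifs
    · exact Commute.self_pow _ _
    · exact Commute.zero_right _
  rw [conjSupp, conjSupp, powSupp_add hn hm hS, h, neg_add, mul_assoc, ← (hcomm _).eq]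
  simp only [mul_assoc]

theorem conjSupp_anticomm [NeZero n] (hn : n = p * m) (hm : 0 < m) (h : CyclicClifford_s1 p S X)
    {a b : ZMod n} (hab : a ≠ b) :
    conjSupp n m S X a * conjSupp n m S X b + conjSupp n m S X b * conjSupp n m S X a = 0 := by
  have key : ∀ i j, i < j → j < p →
      (S ^ i * X * S ^ (p - i)) * (S ^ j * X * S ^ (p - j)) +
        (S ^ j * X * S ^ (p - j)) * (S ^ i * X * S ^ (p - i)) = 0 := by
    intro i j hij hj
    obtain ⟨d, rfl⟩ := Nat.exists_eq_add_of_lt hij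
    have h₁ : S ^ (p - i) * S ^ (i + d + 1) = S ^ (d + 1) := by
      rw [← pow_add, show p - i + (i + d + 1) = p + (d + 1) by lia, pow_add, h.pow_eq_one, one_mul]
    have h₂ : S ^ (p - (i + d + 1)) * S ^ i = S ^ (p - (d + 1)) := by
      rw [← pow_add]; congr 1; lia
    have h₃ : S ^ (p - (i + d + 1)) = S ^ (p - (d + 1)) * S ^ (p - i) := by
      rw [← pow_add, show p - (d + 1) + (p - i) = p - (i + d + 1) + p by lia, pow_add S _ p,
        h.pow_eq_one, mul_one]
    have h₄ := congrArg (fun y => S ^ i * y * S ^ (p - i)) (h.anticomm (d + 1) (by lia) (by lia))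
    simp only [mul_zero, zero_mul] at h₄
    rw [← h₄]
    calc _ = S ^ i * X * (S ^ (p - i) * S ^ (i + d + 1)) * X * S ^ (p - (i + d + 1)) +
          S ^ (i + d + 1) * X * (S ^ (p - (i + d + 1)) * S ^ i) * X * S ^ (p - i) := by
            simp only [mul_assoc]
      _ = _ := by
        rw [h₁, h₂, h₃, add_assoc i, pow_add S i]
        simp only [mul_assoc, mul_add, add_mul]
  by_cases ha : m ∣ a.val
  swap
  · simp [conjSupp_of_not_dvd ha]
  by_cases hb : m ∣ b.val
  swap
  · simp [conjSupp_of_not_dvd hb]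
  obtain ⟨i, hi, rfl⟩ := exists_eq_natCast_mul hn ha
  obtain ⟨j, hj, rfl⟩ := exists_eq_natCast_mul hn hb
  rw [conjSupp_natCast_mul hn hm h.pow_eq_one hi.le, conjSupp_natCast_mul hn hm h.pow_eq_one hj.le]
  rcases lt_trichotomy i j with hij | rfl | hij
  · exact key i j hij hj
  · exact absurd rfl hab
  · rw [add_comm]
    exact key j i hij hi

end Index

section Module

variable {k : Type*} [Field k] {B : Type*} [Ring B] [Algebra k B] {n m p : ℕ} {S X : B}

variable (k n m S) in
/-- The `S`-equivariant functions `ZMod n → B`: the underlying space of the representation of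
`A # C_n` induced from the subgroup generated by `s ^ m`. -/
def equivariant : Submodule k (ZMod n → B) where
  carrier := {f | ∀ a, f (a + m) = S * f a}
  add_mem' hf hg a := by simp [hf a, hg a, mul_add]
  zero_mem' a := by simp
  smul_mem' c f hf a := by simp [hf a]

variable (k n m S) in
/-- The action of `s` on equivariant functions. -/
def shiftAct : Module.End k (equivariant k n m S) where
  toFun f := ⟨fun a => f.1 (a + 1), fun a => by
    change f.1 (a + m + 1) = S * f.1 (a + 1)
    rw [add_right_comm, f.2]⟩
  map_add' _ _ := rfl
  map_smul' _ _ := rfl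

/-- The action of `x_i` on equivariant functions, rescaled by `t`. -/
def genAct [NeZero n] (hn : n = p * m) (hm : 0 < m) (h : CyclicClifford_s1 p S X) (t : k)
    (i : ZMod n) : Module.End k (equivariant k n m S) where
  toFun f := ⟨fun a => t • (conjSupp n m S X (i + a) * f.1 a), fun a => by
    beta_reduce
    rw [f.2, ← add_assoc, ← mul_assoc, conjSupp_add_mul hn hm h.pow_eq_one, mul_assoc,
      mul_smul_comm]⟩
  map_add' f g := by ext a; simp [mul_add]
  map_smul' c f := by ext a; simp [smul_comm t c]

theorem shiftAct_pow_apply (j : ℕ) (f : equivariant k n m S) (a : ZMod n) :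
    ((shiftAct k n m S ^ j) f).1 a = f.1 (a + j) := by
  induction j generalizing f with
  | zero => simp
  | succ j ih =>
    rw [pow_succ, Module.End.mul_apply, ih]
    simp [shiftAct, add_assoc]

theorem equivariant_apply_add_mul (f : equivariant k n m S) (q : ℕ) (a : ZMod n) :
    f.1 (a + (q * m : ℕ)) = S ^ q * f.1 a := by
  induction q with
  | zero => simp
  | succ q ih =>
    rw [add_mul, one_mul, Nat.cast_add, ← add_assoc, f.2, ih, pow_succ', mul_assoc]

theorem sum_range_mul {M : Type*} [AddCommMonoid M] (F : ℕ → M) (p m : ℕ) :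
    ∑ j ∈ Finset.range (p * m), F j =
      ∑ q ∈ Finset.range p, ∑ r ∈ Finset.range m, F (q * m + r) := by
  induction p with
  | zero => simp
  | succ p ih => rw [add_mul, one_mul, Finset.sum_range_add, ih, Finset.sum_range_succ]

theorem sum_shiftAct_pow (hn : n = p * m) (h : CyclicClifford_s1 p S X) :
    ∑ j ∈ Finset.range n, shiftAct k n m S ^ j = 0 := by
  ext f a
  simp only [LinearMap.sum_apply, AddSubmonoidClass.coe_finsetSum, Finset.sum_apply,
    shiftAct_pow_apply, LinearMap.zero_apply, ZeroMemClass.coe_zero, Pi.zero_apply]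
  calc ∑ j ∈ Finset.range n, f.1 (a + j) = ∑ j ∈ Finset.range (p * m), f.1 (a + j) :=
        Finset.sum_congr (congrArg Finset.range hn) fun _ _ => rfl
    _ = ∑ q ∈ Finset.range p, ∑ r ∈ Finset.range m, f.1 (a + (q * m + r : ℕ)) :=
        sum_range_mul _ p m
    _ = ∑ r ∈ Finset.range m, (∑ q ∈ Finset.range p, S ^ q) * f.1 (a + r) := by
        rw [Finset.sum_comm]
        refine Finset.sum_congr rfl fun r _ => ?_
        rw [Finset.sum_mul]
        refine Finset.sum_congr rfl fun q _ => ?_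
        rw [← equivariant_apply_add_mul, Nat.cast_add, add_assoc, add_comm (r : ZMod n)]
    _ = 0 := by simp [h.sum_pow]

theorem exists_algHom [NeZero n] (hn : n = p * m) (hm : 0 < m) (h : CyclicClifford_s1 p S X)
    (t : k) : ∃ Φ : Equot k n →ₐ[k] Module.End k (equivariant k n m S),
      Φ (RingQuot.mkAlgHom k _ (xg k n 0)) = genAct hn hm h t 0 := by
  let F : FreeAlgebra k (ZMod n ⊕ Unit) →ₐ[k] Module.End k (equivariant k n m S) :=
    FreeAlgebra.lift k (Sum.elim (genAct hn hm h t) fun _ => shiftAct k n m S)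
  have hF : ∀ ⦃u v⦄, SGRel k n u v → F u = F v := by
    rintro _ _ (⟨i, j, hij⟩ | _ | i)
    · ext f a
      have := conjSupp_anticomm hn hm h (a := i + a) (b := j + a) (by simpa using hij)
      have := congrArg (fun y => t • t • (y * f.1 a)) this
      simpa [F, genAct, add_mul, mul_assoc] using this
    · ext f a
      simp [F, shiftAct_pow_apply]
    · ext f a
      simp [F, genAct, shiftAct, add_assoc, add_comm a 1]
  let G := RingQuot.liftAlgHom k ⟨F, hF⟩
  have hG : ∀ ⦃u v⦄, (u = e0 k n ∧ v = 0) → G u = G v := by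
    rintro _ _ ⟨rfl, rfl⟩
    have hs : G (sg k n) = shiftAct k n m S := by
      simp [G, sg, F]
    rw [e0, map_smul, map_sum, map_zero]
    simp only [map_pow, hs]
    rw [sum_shiftAct_pow hn h, smul_zero]
  refine ⟨RingQuot.liftAlgHom k ⟨G, hG⟩, ?_⟩
  simp [G, xg, F]

theorem genAct_mul_genAct_apply_zero [NeZero n] (hn : n = p * m) (hm : 0 < m)
    (h : CyclicClifford_s1 p S X) (t : k) (f : equivariant k n m S) :
    ((genAct hn hm h t 0 * genAct hn hm h t 0) f).1 0 = (t * t) • f.1 0 := by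
  have h0 : conjSupp n m S X 0 = X := by
    simpa [h.pow_eq_one] using conjSupp_natCast_mul (X := X) hn hm h.pow_eq_one (Nat.zero_le p)
  simp [genAct, h0, ← mul_assoc, h.sq_eq_one, smul_smul]

theorem not_finiteDimensional_of_cyclicClifford [IsAlgClosed k] [Nontrivial B] [NeZero n]
    (hn : n = p * m) (h : CyclicClifford_s1 p S X) : ¬ FiniteDimensional k (Equot k n) := by
  intro hfin
  have hm : 0 < m := by
    refine Nat.pos_of_ne_zero fun h0 => NeZero.ne n ?_
    rw [hn, h0, mul_zero]
  let y : Equot k n := RingQuot.mkAlgHom k _ (xg k n 0)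
  obtain ⟨P, hP, hPy⟩ := (IsIntegral.of_finite k (y * y)).isAlgebraic
  refine hP (Polynomial.funext fun r => ?_)
  obtain ⟨t, ht⟩ := IsAlgClosed.exists_pow_nat_eq r (n := 2) two_pos
  obtain ⟨Φ, hΦ⟩ := exists_algHom hn hm h t
  have hT (f : equivariant k n m S) : (Φ (y * y) f).1 0 = r • f.1 0 := by
    rw [map_mul, hΦ, genAct_mul_genAct_apply_zero, ← ht, sq]
  have hpow (j : ℕ) (f : equivariant k n m S) : ((Φ (y * y) ^ j) f).1 0 = r ^ j • f.1 0 := by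
    induction j with
    | zero => simp
    | succ j ih => rw [pow_succ', Module.End.mul_apply, hT, ih, smul_smul, pow_succ']
  have heval (f : equivariant k n m S) :
      (Polynomial.aeval (Φ (y * y)) P f).1 0 = P.eval r • f.1 0 := by
    rw [Polynomial.aeval_eq_sum_range, Polynomial.eval_eq_sum_range, Finset.sum_smul]
    simp [-map_mul, LinearMap.sum_apply, hpow, smul_smul]
  let g : equivariant k n m S := ⟨powSupp n m S, powSupp_add hn hm h.pow_eq_one⟩
  have hg : g.1 0 = 1 := by
    simpa using powSupp_natCast_mul hn hm h.pow_eq_one 0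
  have := heval g
  rw [Polynomial.aeval_algHom_apply, hPy, hg] at this
  simpa using this.symm

end Module

end NCIS

open NCIS in
/-- Theorem 0.4: if `n ≥ 2` is divisible by `3` or by `5`, then
`E = (A#C_n)/(e₀)` is infinite-dimensional over `k`. -/
theorem skewGroup_quotient_not_finiteDimensional_of_three_or_five_dvd
    (k : Type*) [Field k] [IsAlgClosed k] [CharZero k]
    (n : ℕ) (hn2 : 2 ≤ n) (hdvd : 3 ∣ n ∨ 5 ∣ n) :
    ¬ FiniteDimensional k (Equot k n) := by
  obtain ⟨I, hI⟩ := IsAlgClosed.exists_pow_nat_eq (-1 : k) (n := 2) two_pos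
  rw [sq] at hI
  have : NeZero n := ⟨by lia⟩
  rcases hdvd with ⟨m, hm⟩ | ⟨m, hm⟩
  · exact not_finiteDimensional_of_cyclicClifford hm (cyclicClifford_three I hI)
  · exact not_finiteDimensional_of_cyclicClifford hm (cyclicClifford_five I hI)
end

section
/- For every integer n ≥ 2, GKdim E ≤ n − |φ₂(n)|, where φ₂(n) := {k : 0 ≤ k ≤ n−1 and gcd(k,n) = 2^w for some integer w ≥ 0}. Equivalently, the pertinency p(A, C_n) = n − GKdim E is at least |φ₂(n)|. -/
open scoped BigOperators

namespace NCIS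

variable (k : Type*) [Field k] (n : ℕ)

/-- The Gelfand–Kirillov dimension of an algebra `B` with respect to a generating
subspace `V ∋ 1`:  `limsup_{m → ∞} log(dim_k V^m) / log m`, where `V^m` is the span of
all products of `m` elements of `V` (which, since `1 ∈ V`, is the span of all products of
at most `m` elements of `V`). -/
noncomputable def gkdim (B : Type*) [Ring B] [Algebra k B] (V : Submodule k B) : ℝ :=
  Filter.limsup
    (fun m : ℕ => Real.log (Module.finrank k (V ^ m : Submodule k B)) / Real.log m)
    Filter.atTop

/-- The standard generating subspace of `E = (A#C_n)/(e₀)`: the span of `1` and of the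
images of `x_0, …, x_{n-1}` and `s`. -/
noncomputable def Vgen : Submodule k (Equot k n) :=
  Submodule.span k
    (insert (1 : Equot k n)
      (insert (RingQuot.mkAlgHom k (fun a b : SkewGroup k n => a = e0 k n ∧ b = 0) (sg k n))
        (Set.range (fun i : ZMod n =>
          RingQuot.mkAlgHom k (fun a b : SkewGroup k n => a = e0 k n ∧ b = 0) (xg k n i)))))

end NCIS

namespace NCIS

section FourierRelations

variable {k : Type*} [Field k] {n : ℕ} {B : Type*} [Ring B] [Algebra k B]

/-- The defining relations of `E = (A # C_n)/(e₀)` for a family `x` and an element `s` of a ring. -/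
structure IsSkewCyclic (x : ZMod n → B) (s : B) : Prop where
  anti : ∀ i j, i ≠ j → x i * x j + x j * x i = 0
  s_pow : s ^ n = 1
  s_comm : ∀ i, s * x i = x (i + 1) * s
  sum_pow : ∑ i ∈ Finset.range n, s ^ i = 0

/-- The Fourier transform of a family `v` indexed by `ZMod n`, along the additive character `ψ`. -/
noncomputable def fourier [NeZero n] (ψ : AddChar (ZMod n) k) (v : ZMod n → B) (c : ZMod n) : B :=
  ∑ i, ψ (i * c) • v i

/-- The character sum `∑ ψ(i j) s^i`, a multiple of an idempotent of the group algebra. -/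
noncomputable def charSum (ψ : AddChar (ZMod n) k) (s : B) (j : ZMod n) : B :=
  ∑ i ∈ Finset.range n, ψ (i * j) • s ^ i

variable {x : ZMod n → B} {s : B} {ψ : AddChar (ZMod n) k}

lemma IsSkewCyclic.commute_sq (h : IsSkewCyclic x s) (i j : ZMod n) : Commute (x i) (x j ^ 2) := by
  rcases eq_or_ne i j with rfl | hij
  · exact Commute.pow_right rfl 2
  · have h' : x i * x j = -(x j * x i) := eq_neg_of_add_eq_zero_left (h.anti i j hij)
    rw [Commute, SemiconjBy, sq, ← mul_assoc, h', neg_mul, mul_assoc, h', mul_neg, neg_neg,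
      mul_assoc]

lemma IsSkewCyclic.charSum_zero (h : IsSkewCyclic x s) : charSum ψ s 0 = 0 := by
  simpa [charSum] using h.sum_pow

lemma IsSkewCyclic.s_comm_sq (h : IsSkewCyclic x s) (i : ZMod n) :
    s * x i ^ 2 = x (i + 1) ^ 2 * s := by
  rw [sq, ← mul_assoc, h.s_comm, mul_assoc, h.s_comm, ← mul_assoc, sq]

variable [NeZero n]

lemma s_mul_fourier {v : ZMod n → B} (hv : ∀ i, s * v i = v (i + 1) * s) (c : ZMod n) :
    s * fourier ψ v c = ψ (-c) • (fourier ψ v c * s) := by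
  have : fourier ψ v c = ψ c • ∑ i, ψ (i * c) • v (i + 1) := by
    rw [fourier, ← Equiv.sum_comp (Equiv.addRight (1 : ZMod n)), Finset.smul_sum]
    refine Finset.sum_congr rfl fun i _ => ?_
    rw [smul_smul, ← AddChar.map_add_eq_mul, Equiv.coe_addRight, add_mul, one_mul, add_comm]
  nth_rw 2 [this]
  rw [smul_mul_assoc, smul_smul, ← AddChar.map_add_eq_mul, neg_add_cancel, AddChar.map_zero_eq_one,
    one_smul, fourier, Finset.mul_sum, Finset.sum_mul]
  simp [hv]

lemma s_pow_mul_fourier {v : ZMod n → B} (hv : ∀ i, s * v i = v (i + 1) * s) (c : ZMod n)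
    (a : ℕ) : s ^ a * fourier ψ v c = ψ (a * -c) • (fourier ψ v c * s ^ a) := by
  induction a with
  | zero => simp
  | succ a ih =>
    rw [pow_succ', mul_assoc, ih, mul_smul_comm, ← mul_assoc, s_mul_fourier hv, smul_mul_assoc,
      smul_smul, ← AddChar.map_add_eq_mul, mul_assoc]
    congr 2
    push_cast
    ring

lemma charSum_mul_fourier {v : ZMod n → B} (hv : ∀ i, s * v i = v (i + 1) * s) (j c : ZMod n) :
    charSum ψ s j * fourier ψ v c = fourier ψ v c * charSum ψ s (j - c) := by
  rw [charSum, charSum, Finset.sum_mul, Finset.mul_sum]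
  refine Finset.sum_congr rfl fun i _ => ?_
  rw [smul_mul_assoc, s_pow_mul_fourier hv, smul_smul, ← AddChar.map_add_eq_mul, mul_smul_comm]
  congr 2
  ring

/-- The Fourier transform of the central elements `x i ^ 2`. -/
noncomputable abbrev sqFourier (ψ : AddChar (ZMod n) k) (x : ZMod n → B) : ZMod n → B :=
  fourier ψ fun i => x i ^ 2

lemma IsSkewCyclic.commute_sqFourier (h : IsSkewCyclic x s) (i c : ZMod n) :
    Commute (x i) (sqFourier ψ x c) :=
  Commute.sum_right _ _ _ fun j _ => (h.commute_sq i j).smul_right _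

lemma IsSkewCyclic.fourier_commute_sqFourier (h : IsSkewCyclic x s) (a c : ZMod n) :
    Commute (fourier ψ x a) (sqFourier ψ x c) :=
  Commute.sum_left _ _ _ fun i _ => (h.commute_sqFourier i c).smul_left _

lemma IsSkewCyclic.sqFourier_commute (h : IsSkewCyclic x s) (a c : ZMod n) :
    Commute (sqFourier ψ x a) (sqFourier ψ x c) :=
  Commute.sum_left _ _ _ fun i _ => ((h.commute_sqFourier i c).pow_left 2).smul_left _

lemma IsSkewCyclic.fourier_anticomm (h : IsSkewCyclic x s) (a b : ZMod n) :
    fourier ψ x a * fourier ψ x b + fourier ψ x b * fourier ψ x a =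
      (2 : k) • sqFourier ψ x (a + b) := by
  have expand : fourier ψ x a * fourier ψ x b + fourier ψ x b * fourier ψ x a =
      ∑ i, ∑ j, ψ (i * a + j * b) • (x i * x j + x j * x i) := by
    simp only [smul_add, Finset.sum_add_distrib]
    congr 1
    · simp only [fourier, Finset.sum_mul_sum]
      refine Finset.sum_congr rfl fun i _ => Finset.sum_congr rfl fun j _ => ?_
      rw [smul_mul_smul_comm, AddChar.map_add_eq_mul]
    · simp only [fourier, Finset.sum_mul_sum]
      rw [Finset.sum_comm]
      refine Finset.sum_congr rfl fun i _ => Finset.sum_congr rfl fun j _ => ?_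
      rw [smul_mul_smul_comm, AddChar.map_add_eq_mul, mul_comm (ψ _)]
  rw [expand, sqFourier, fourier, Finset.smul_sum]
  refine Finset.sum_congr rfl fun i _ => ?_
  rw [Finset.sum_eq_single i]
  · rw [← sq, ← two_smul k (x i ^ 2), smul_comm, ← mul_add]
  · intro j _ hj
    rw [h.anti i j hj.symm, smul_zero]
  · simp

lemma IsSkewCyclic.charSum_mul_sqFourier (h : IsSkewCyclic x s) (j c : ZMod n) :
    charSum ψ s j * sqFourier ψ x c = sqFourier ψ x c * charSum ψ s (j - c) :=
  charSum_mul_fourier h.s_comm_sq j c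

lemma IsSkewCyclic.charSum_nsmul_mul_pow (h : IsSkewCyclic x s) (c : ZMod n) (a : ℕ) :
    charSum ψ s (a * c) * sqFourier ψ x c ^ a = 0 := by
  induction a with
  | zero => simp [h.charSum_zero]
  | succ a ih =>
    rw [pow_succ', ← mul_assoc, h.charSum_mul_sqFourier, mul_assoc]
    have : ((a + 1 : ℕ) : ZMod n) * c - c = a * c := by push_cast; ring
    rw [this, ih, mul_zero]

lemma IsSkewCyclic.charSum_mul_mul_pow (h : IsSkewCyclic x s) (t c : ZMod n) :
    charSum ψ s (t * c) * sqFourier ψ x c ^ n = 0 := by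
  have key := h.charSum_nsmul_mul_pow (ψ := ψ) c t.val
  rw [ZMod.natCast_zmod_val] at key
  rw [← pow_mul_pow_sub _ t.val_lt.le, ← mul_assoc, key, zero_mul]

lemma IsSkewCyclic.charSum_mul_pow_succ [CharZero k] (h : IsSkewCyclic x s) {j c : ZMod n} {N : ℕ}
    (hj : charSum ψ s (2 * j - c) * sqFourier ψ x c ^ N = 0) :
    charSum ψ s j * sqFourier ψ x c ^ (N + 1) = 0 := by
  have h2 : (2 : k) • (charSum ψ s j * sqFourier ψ x c ^ (N + 1)) = 0 := by
    have anti := h.fourier_anticomm (ψ := ψ) j (c - j)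
    rw [add_sub_cancel] at anti
    have comm (a : ZMod n) := (h.fourier_commute_sqFourier (ψ := ψ) a c).pow_right N
    rw [pow_succ', ← mul_smul_comm, ← smul_mul_assoc, ← anti, add_mul, mul_assoc, mul_assoc,
      (comm _).eq, (comm _).eq, mul_add, ← mul_assoc, charSum_mul_fourier h.s_comm, sub_self,
      h.charSum_zero, mul_zero, zero_mul, zero_add, ← mul_assoc, charSum_mul_fourier h.s_comm,
      mul_assoc, ← mul_assoc (charSum ψ s _), show j - (c - j) = 2 * j - c by ring, hj, zero_mul,
      mul_zero]
  exact (smul_eq_zero.mp h2).resolve_left two_ne_zero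

lemma IsSkewCyclic.charSum_mul_pow_add [CharZero k] (h : IsSkewCyclic x s) {c : ZMod n} {N : ℕ}
    (r : ℕ) (j : ZMod n) (hj : charSum ψ s (c + 2 ^ r * (j - c)) * sqFourier ψ x c ^ N = 0) :
    charSum ψ s j * sqFourier ψ x c ^ (N + r) = 0 := by
  induction r generalizing j with
  | zero => simpa using hj
  | succ r ih =>
    refine h.charSum_mul_pow_succ (ih _ ?_)
    rwa [show c + 2 ^ r * (2 * j - c - c) = c + 2 ^ (r + 1) * (j - c) by ring]

lemma sum_charSum (hψ : ψ.IsPrimitive) : ∑ j, charSum ψ s j = (n : k) • (1 : B) := by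
  simp only [charSum]
  rw [Finset.sum_comm, Finset.sum_eq_single_of_mem 0 (by simp [NeZero.pos])]
  · simp [Algebra.smul_def]
  · intro i hi h0
    rw [← Finset.sum_smul]
    have := AddChar.sum_mulShift (ψ := ψ) (i : ZMod n) hψ
    rw [if_neg] at this
    · simp only [mul_comm] at this ⊢
      simp_all
    · rw [ZMod.natCast_eq_zero_iff]
      exact Nat.not_dvd_of_pos_of_lt (Nat.pos_of_ne_zero h0) (Finset.mem_range.mp hi)

/-- If `gcd(c, n)` is a power of two, then the Fourier coefficient `z_c` of the squares `x i ^ 2`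
is nilpotent. -/
theorem IsSkewCyclic.sqFourier_pow_eq_zero [CharZero k] (h : IsSkewCyclic x s)
    (hψ : ψ.IsPrimitive) {c : ZMod n} {w : ℕ} (hw : Nat.gcd c.val n = 2 ^ w) :
    sqFourier ψ x c ^ (2 * n) = 0 := by
  have hwn : w ≤ n :=
    Nat.lt_two_pow_self.le.trans (Nat.le_of_dvd (NeZero.pos n) (hw ▸ Nat.gcd_dvd_right _ _))
  have hpow : (2 : ZMod n) ^ w = c * (Nat.gcdA c.val n : ℤ) := by
    have := congrArg (Int.cast : ℤ → ZMod n) (Nat.gcd_eq_gcd_ab c.val n)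
    rw [hw] at this
    simpa using this
  have hj (j : ZMod n) : charSum ψ s j * sqFourier ψ x c ^ (n + w) = 0 := by
    refine h.charSum_mul_pow_add w j ?_
    rw [hpow, show c + c * (Nat.gcdA c.val n : ℤ) * (j - c) =
      (1 + (Nat.gcdA c.val n : ℤ) * (j - c)) * c by ring]
    exact h.charSum_mul_mul_pow _ c
  have hz : (n : k) • sqFourier ψ x c ^ (n + w) = 0 := by
    rw [← one_mul (sqFourier ψ x c ^ (n + w)), ← smul_mul_assoc, ← sum_charSum (s := s) hψ,
      Finset.sum_mul, Finset.sum_eq_zero fun j _ => hj j]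
  have hz' := (smul_eq_zero.mp hz).resolve_left (NeZero.ne _)
  exact pow_eq_zero_of_le (by omega) hz'

/-- Fourier inversion. -/
lemma sum_smul_fourier (hψ : ψ.IsPrimitive) (v : ZMod n → B) (i : ZMod n) :
    ∑ c, ψ (c * -i) • fourier ψ v c = (n : k) • v i := by
  simp only [fourier, Finset.smul_sum, smul_smul, ← AddChar.map_add_eq_mul]
  rw [Finset.sum_comm, Finset.sum_eq_single i]
  · simp [mul_comm, Algebra.smul_def]
  · intro j _ hj
    rw [← Finset.sum_smul]
    have := AddChar.sum_mulShift (ψ := ψ) (j - i) hψ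
    rw [if_neg (sub_ne_zero.mpr hj)] at this
    rw [Finset.sum_congr rfl fun c _ => by rw [show c * -i + j * c = c * (j - i) by ring], this]
    simp
  · simp

end FourierRelations

end NCIS

namespace NCIS

section Growth

variable {k : Type*} [Field k] {B : Type*} [Ring B] [Algebra k B]

open Submodule

/-- The submodule `S` lies in the span of at most `N` elements. -/
def SpanCardLE (S : Submodule k B) (N : ℕ) : Prop :=
  ∃ T : Finset B, S ≤ span k (T : Set B) ∧ T.card ≤ N

lemma SpanCardLE.mono {S S' : Submodule k B} {N : ℕ} (h : SpanCardLE S' N) (hS : S ≤ S') :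
    SpanCardLE S N :=
  let ⟨T, hT, hc⟩ := h
  ⟨T, hS.trans hT, hc⟩

open scoped Pointwise in
lemma SpanCardLE.mul {S S' : Submodule k B} {N N' : ℕ} (h : SpanCardLE S N)
    (h' : SpanCardLE S' N') : SpanCardLE (S * S') (N * N') := by
  classical
  obtain ⟨T, hT, hc⟩ := h
  obtain ⟨T', hT', hc'⟩ := h'
  refine ⟨T * T', ?_, Finset.card_mul_le.trans (Nat.mul_le_mul hc hc')⟩
  rw [Finset.coe_mul, ← span_mul_span]
  exact mul_le_mul' hT hT'

lemma SpanCardLE.listProd {ι : Type*} {S : ι → Submodule k B} {N : ι → ℕ}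
    (h : ∀ i, SpanCardLE (S i) (N i)) (l : List ι) :
    SpanCardLE (l.map S).prod (l.map N).prod := by
  induction l with
  | nil => exact ⟨{1}, by simp [one_eq_span], by simp⟩
  | cons a l ih => simpa using (h a).mul ih

lemma SpanCardLE.of_image {ι : Type*} (f : ι → B) (t : Finset ι) {S : Submodule k B}
    (h : S ≤ span k (f '' t)) : SpanCardLE S t.card := by
  classical
  exact ⟨t.image f, by simpa using h, Finset.card_image_le⟩

lemma SpanCardLE.finrank_le {S : Submodule k B} {N : ℕ} (h : SpanCardLE S N) :
    Module.finrank k S ≤ N := by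
  obtain ⟨T, hT, hc⟩ := h
  exact (Submodule.finrank_mono hT).trans ((finrank_span_finset_le_card T).trans hc)

lemma span_mul_span_le {S T : Set B} {P : Submodule k B} (h : ∀ a ∈ S, ∀ b ∈ T, a * b ∈ P) :
    span k S * span k T ≤ P := by
  rw [span_mul_span, span_le]
  exact Set.mul_subset_iff.mpr h

/-- The span of `1` and the elements `v i`. -/
def unitSpan (k : Type*) [Field k] {B : Type*} [Ring B] [Algebra k B] {ι : Type*}
    (v : ι → B) : Submodule k B :=
  span k (insert 1 (Set.range v))

lemma one_mem_unitSpan {ι : Type*} (v : ι → B) : 1 ∈ unitSpan k v :=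
  subset_span (Set.mem_insert _ _)

lemma mem_unitSpan {ι : Type*} (v : ι → B) (i : ι) : v i ∈ unitSpan k v :=
  subset_span (Set.mem_insert_of_mem _ ⟨i, rfl⟩)

/-- The span of the powers `z ^ i` with `i ≤ m`. -/
def powSpan (k : Type*) [Field k] {B : Type*} [Ring B] [Algebra k B] (z : B) (m : ℕ) :
    Submodule k B :=
  span k ((fun i : ℕ => z ^ i) '' (Finset.range (m + 1) : Finset ℕ))

lemma powSpan_mono (z : B) (m : ℕ) : powSpan k z m ≤ powSpan k z (m + 1) :=
  span_mono (Set.image_mono (by simp))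

lemma spanCardLE_powSpan (z : B) (m : ℕ) : SpanCardLE (powSpan k z m) (m + 1) := by
  simpa [powSpan] using
    SpanCardLE.of_image (k := k) (fun i : ℕ => z ^ i) (Finset.range (m + 1)) le_rfl

lemma spanCardLE_powSpan_of_pow_eq_zero {z : B} {N : ℕ} (hz : z ^ N = 0) (m : ℕ) :
    SpanCardLE (powSpan k z m) N := by
  have := SpanCardLE.of_image (k := k) (S := powSpan k z m) (fun i : ℕ => z ^ i) (Finset.range N) ?_
  · simpa using this
  rw [powSpan, span_le]
  rintro _ ⟨i, -, rfl⟩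
  rcases lt_or_ge i N with hi | hi
  · exact subset_span ⟨i, by simpa using hi, rfl⟩
  · simp [pow_eq_zero_of_le hi hz]

lemma listProd_map_mono {ι : Type*} {S T : ι → Submodule k B} (h : ∀ i, S i ≤ T i) (l : List ι) :
    (l.map S).prod ≤ (l.map T).prod := by
  induction l with
  | nil => simp
  | cons a l ih => simpa using mul_le_mul' (h a) ih

lemma span_mul_listProd_powSpan_le {ι : Type*} {z : ι → B} (hz : ∀ i j, Commute (z i) (z j))
    (m : ℕ) {c : ι} {l : List ι} (hc : c ∈ l) :
    span k {z c} * (l.map fun i => powSpan k (z i) m).prod ≤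
      (l.map fun i => powSpan k (z i) (m + 1)).prod := by
  induction l with
  | nil => simp at hc
  | cons a l ih =>
    rw [List.map_cons, List.prod_cons, List.map_cons, List.prod_cons, ← mul_assoc]
    rcases eq_or_ne c a with rfl | hne
    · refine mul_le_mul' (span_mul_span_le ?_) (listProd_map_mono (fun i => powSpan_mono _ m) l)
      rintro _ rfl _ ⟨i, hi, rfl⟩
      exact subset_span ⟨i + 1, by simpa using hi, pow_succ' _ _⟩
    · have swap : span k {z c} * powSpan k (z a) m ≤ powSpan k (z a) (m + 1) * span k {z c} := by
        refine le_trans (span_mul_span_le ?_) (mul_le_mul' (powSpan_mono (z a) m) le_rfl)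
        rintro _ rfl _ ⟨i, hi, rfl⟩
        rw [((hz c a).pow_right i).eq]
        exact mul_mem_mul (subset_span ⟨i, hi, rfl⟩) (mem_span_singleton_self _)
      refine (mul_le_mul' swap le_rfl).trans ?_
      rw [mul_assoc]
      exact mul_le_mul' le_rfl (ih (List.mem_of_ne_of_mem hne hc))

lemma unitSpan_pow_le {ι : Type*} {z : ι → B} (hz : ∀ i j, Commute (z i) (z j))
    {l : List ι} (hl : ∀ i, i ∈ l) (m : ℕ) :
    unitSpan k z ^ m ≤ (l.map fun i => powSpan k (z i) m).prod := by
  induction m with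
  | zero =>
    rw [pow_zero]
    clear hl
    induction l with
    | nil => simp
    | cons a l ih =>
      rw [List.map_cons, List.prod_cons]
      refine (one_mul (1 : Submodule k B)).ge.trans (mul_le_mul' (Submodule.one_le.mpr ?_) ih)
      exact subset_span ⟨0, by simp⟩
  | succ m ih =>
    rw [pow_succ']
    refine (mul_le_mul' le_rfl ih).trans (Submodule.mul_le.mpr fun a ha b hb => ?_)
    induction ha using span_induction with
    | mem a ha =>
      rcases ha with rfl | ⟨c, rfl⟩
      · rw [one_mul]
        exact listProd_map_mono (fun i => powSpan_mono _ m) l hb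
      · exact span_mul_listProd_powSpan_le hz m (hl c)
          (mul_mem_mul (mem_span_singleton_self _) hb)
    | zero => simp
    | add a a' _ _ h h' => rw [add_mul]; exact add_mem h h'
    | smul r a _ h => rw [smul_mul_assoc]; exact smul_mem _ r h

variable {n : ℕ} {x : ZMod n → B} {s : B} {ψ : AddChar (ZMod n) k}

/-- The span of the square-free monomials in the `x i`, for `i` in the list `l`. -/
def monomialSpan (k : Type*) [Field k] {B : Type*} [Ring B] [Algebra k B] {ι : Type*} (x : ι → B)
    (l : List ι) : Submodule k B :=
  (l.map fun i => span k {1, x i}).prod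

lemma IsSkewCyclic.span_mul_monomialSpan_le (h : IsSkewCyclic x s) {D : Submodule k B}
    (hone : 1 ∈ D) (hsq : ∀ i, x i ^ 2 ∈ D) (hcomm : ∀ i, ∀ d ∈ D, Commute (x i) d)
    {i : ZMod n} {l : List (ZMod n)} (hi : i ∈ l) :
    span k {x i} * monomialSpan k x l ≤ D * monomialSpan k x l := by
  induction l with
  | nil => simp at hi
  | cons a l ih =>
    have hcons : monomialSpan k x (a :: l) = span k {1, x a} * monomialSpan k x l := by
      simp [monomialSpan]
    rw [hcons, ← mul_assoc]
    have mem_one : (1 : B) ∈ span k {1, x a} := subset_span (by simp)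
    have mem_x : x a ∈ span k {1, x a} := subset_span (by simp)
    rcases eq_or_ne i a with rfl | hne
    · rw [← mul_assoc]
      refine mul_le_mul' (span_mul_span_le ?_) le_rfl
      rintro _ rfl _ (rfl | rfl)
      · simpa using mul_mem_mul hone mem_x
      · simpa [sq] using mul_mem_mul (hsq i) mem_one
    · have swap : span k {x i} * span k {1, x a} ≤ span k {1, x a} * span k {x i} := by
        refine span_mul_span_le ?_
        rintro _ rfl _ (rfl | rfl)
        · simpa using mul_mem_mul mem_one (mem_span_singleton_self (x i))
        · rw [eq_neg_of_add_eq_zero_left (h.anti i a hne)]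
          exact neg_mem (mul_mem_mul mem_x (mem_span_singleton_self _))
      have swapD : span k {1, x a} * D ≤ D * span k {1, x a} := by
        rw [← span_eq D]
        refine span_mul_span_le ?_
        rintro _ (rfl | rfl) d hd
        · simpa using mul_mem_mul (subset_span hd) mem_one
        · rw [(hcomm a d hd).eq]
          exact mul_mem_mul (subset_span hd) mem_x
      refine (mul_le_mul' swap le_rfl).trans ?_
      rw [mul_assoc]
      refine (mul_le_mul' le_rfl (ih (List.mem_of_ne_of_mem hne hi))).trans ?_
      rw [← mul_assoc, ← mul_assoc]
      exact mul_le_mul' swapD le_rfl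

lemma IsSkewCyclic.unitSpan_mul_monomialSpan_le (h : IsSkewCyclic x s) {D : Submodule k B}
    (hone : 1 ∈ D) (hsq : ∀ i, x i ^ 2 ∈ D) (hcomm : ∀ i, ∀ d ∈ D, Commute (x i) d)
    {l : List (ZMod n)} (hl : ∀ i, i ∈ l) :
    unitSpan k x * monomialSpan k x l ≤ D * monomialSpan k x l := by
  refine Submodule.mul_le.mpr fun a ha b hb => ?_
  induction ha using span_induction with
  | mem a ha =>
    rcases ha with rfl | ⟨i, rfl⟩
    · exact mul_mem_mul hone hb
    · exact h.span_mul_monomialSpan_le hone hsq hcomm (hl i)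
        (mul_mem_mul (mem_span_singleton_self _) hb)
  | zero => simp
  | add a a' _ _ h h' => rw [add_mul]; exact add_mem h h'
  | smul r a _ h => rw [smul_mul_assoc]; exact smul_mem _ r h

lemma IsSkewCyclic.mul_s_pow (h : IsSkewCyclic x s) (i : ZMod n) (a : ℕ) :
    x i * s ^ a = s ^ a * x (i - a) := by
  induction a generalizing i with
  | zero => simp
  | succ a ih =>
    have := h.s_comm (i - 1)
    rw [sub_add_cancel] at this
    rw [pow_succ', ← mul_assoc, ← this, mul_assoc, ih, ← mul_assoc]
    congr 2
    push_cast
    ring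

lemma IsSkewCyclic.span_mul_span_pow_le (h : IsSkewCyclic x s) :
    span k (insert 1 (insert s (Set.range x))) * span k (Set.range fun a : ℕ => s ^ a) ≤
      span k (Set.range fun a : ℕ => s ^ a) * unitSpan k x := by
  have mem_pow (a : ℕ) : s ^ a ∈ span k (Set.range fun a : ℕ => s ^ a) := subset_span ⟨a, rfl⟩
  refine span_mul_span_le ?_
  rintro _ (rfl | rfl | ⟨i, rfl⟩) _ ⟨a, rfl⟩
  · simpa using mul_mem_mul (mem_pow a) (one_mem_unitSpan (k := k) x)
  · simpa [← pow_succ'] using mul_mem_mul (mem_pow (a + 1)) (one_mem_unitSpan (k := k) x)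
  · simp only [h.mul_s_pow]
    exact mul_mem_mul (mem_pow a) (mem_unitSpan _ _)

lemma IsSkewCyclic.pow_le (h : IsSkewCyclic x s) {D : Submodule k B}
    (hone : 1 ∈ D) (hsq : ∀ i, x i ^ 2 ∈ D) (hcomm : ∀ i, ∀ d ∈ D, Commute (x i) d)
    {l : List (ZMod n)} (hl : ∀ i, i ∈ l) (m : ℕ) :
    span k (insert 1 (insert s (Set.range x))) ^ m ≤
      span k (Set.range fun a : ℕ => s ^ a) * (D ^ m * monomialSpan k x l) := by
  have swap : unitSpan k x * D ≤ D * unitSpan k x := by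
    rw [← span_eq D]
    refine span_mul_span_le ?_
    rintro _ (rfl | ⟨i, rfl⟩) d hd
    · simpa using mul_mem_mul (subset_span hd) (one_mem_unitSpan (k := k) x)
    · rw [(hcomm i d hd).eq]
      exact mul_mem_mul (subset_span hd) (mem_unitSpan _ _)
  have swap_pow (m : ℕ) : unitSpan k x * D ^ m ≤ D ^ m * unitSpan k x := by
    induction m with
    | zero => simp
    | succ m ih =>
      calc unitSpan k x * D ^ (m + 1) = unitSpan k x * D ^ m * D := by rw [pow_succ, mul_assoc]
        _ ≤ D ^ m * unitSpan k x * D := mul_le_mul' ih le_rfl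
        _ = D ^ m * (unitSpan k x * D) := mul_assoc _ _ _
        _ ≤ D ^ m * (D * unitSpan k x) := mul_le_mul' le_rfl swap
        _ = D ^ (m + 1) * unitSpan k x := by rw [pow_succ, mul_assoc]
  induction m with
  | zero =>
    have hM : 1 ≤ monomialSpan k x l := by
      clear hl
      induction l with
      | nil => simp [monomialSpan]
      | cons a l ih =>
        rw [monomialSpan, List.map_cons, List.prod_cons]
        exact (one_mul (1 : Submodule k B)).ge.trans
          (mul_le_mul' (Submodule.one_le.mpr (subset_span (by simp))) ih)
    rw [pow_zero, pow_zero, one_mul]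
    exact (one_mul (1 : Submodule k B)).ge.trans
      (mul_le_mul' (Submodule.one_le.mpr (subset_span ⟨0, by simp⟩)) hM)
  | succ m ih =>
    set V := span k (insert 1 (insert s (Set.range x)))
    set G := span k (Set.range fun a : ℕ => s ^ a)
    set M := monomialSpan k x l
    calc V ^ (m + 1) = V * V ^ m := pow_succ' _ _
      _ ≤ V * (G * (D ^ m * M)) := mul_le_mul' le_rfl ih
      _ = V * G * (D ^ m * M) := (mul_assoc _ _ _).symm
      _ ≤ G * unitSpan k x * (D ^ m * M) := mul_le_mul' h.span_mul_span_pow_le le_rfl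
      _ = G * (unitSpan k x * D ^ m * M) := by simp only [mul_assoc]
      _ ≤ G * (D ^ m * unitSpan k x * M) :=
        mul_le_mul' le_rfl (mul_le_mul' (swap_pow m) le_rfl)
      _ = G * (D ^ m * (unitSpan k x * M)) := by simp only [mul_assoc]
      _ ≤ G * (D ^ m * (D * M)) := mul_le_mul' le_rfl
        (mul_le_mul' le_rfl (h.unitSpan_mul_monomialSpan_le hone hsq hcomm hl))
      _ = G * (D ^ (m + 1) * M) := by rw [pow_succ, mul_assoc (D ^ m)]

lemma IsSkewCyclic.spanCardLE_span_pow [NeZero n] (h : IsSkewCyclic x s) :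
    SpanCardLE (span k (Set.range fun a : ℕ => s ^ a)) n := by
  have := SpanCardLE.of_image (k := k) (S := span k (Set.range fun a : ℕ => s ^ a))
    (fun a : ℕ => s ^ a) (Finset.range n) ?_
  · simpa using this
  rw [span_le]
  rintro _ ⟨a, rfl⟩
  exact subset_span
    ⟨a % n, by simpa using Nat.mod_lt a (NeZero.pos n), (pow_eq_pow_mod a h.s_pow).symm⟩

lemma IsSkewCyclic.exists_finrank_pow_le [NeZero n] [CharZero k] (h : IsSkewCyclic x s)
    (hψ : ψ.IsPrimitive) (Φ : Finset (ZMod n))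
    (hΦ : ∀ c ∈ Φ, ∃ w : ℕ, Nat.gcd c.val n = 2 ^ w) :
    ∃ C : ℕ, 0 < C ∧ ∀ m : ℕ,
      Module.finrank k ↥(span k (insert 1 (insert s (Set.range x))) ^ m) ≤
        C * (m + 1) ^ (n - Φ.card) := by
  classical
  set l := (Finset.univ : Finset (ZMod n)).toList
  have hl (i : ZMod n) : i ∈ l := by simp [l]
  set D := unitSpan k (sqFourier ψ x)
  have hsq (i : ZMod n) : x i ^ 2 ∈ D := by
    have hn : (n : k) ≠ 0 := NeZero.ne _
    rw [← inv_smul_smul₀ hn (x i ^ 2), ← sum_smul_fourier hψ (fun i => x i ^ 2)]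
    exact smul_mem _ _ (sum_mem fun c _ => smul_mem _ _ (mem_unitSpan _ c))
  have hcomm (i : ZMod n) : ∀ d ∈ D, Commute (x i) d := fun d hd => by
    induction hd using span_induction with
    | mem d hd =>
      rcases hd with rfl | ⟨c, rfl⟩
      · exact Commute.one_right _
      · exact h.commute_sqFourier i c
    | zero => exact Commute.zero_right _
    | add a b _ _ ha hb => exact ha.add_right hb
    | smul r a _ ha => exact ha.smul_right r
  have hM : ∃ N, SpanCardLE (monomialSpan k x l) N := by
    refine ⟨_, SpanCardLE.listProd (N := fun _ => 2) (fun i => ⟨{1, x i}, by simp, ?_⟩) l⟩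
    exact Finset.card_le_two
  obtain ⟨N, hN⟩ := hM
  refine ⟨n * (2 * n) ^ Φ.card * (N + 1), by have := NeZero.pos n; positivity, fun m => ?_⟩
  have hD : SpanCardLE (D ^ m) ((2 * n) ^ Φ.card * (m + 1) ^ (n - Φ.card)) := by
    have := (SpanCardLE.listProd (N := fun c => if c ∈ Φ then 2 * n else m + 1)
      (S := fun c => powSpan k (sqFourier ψ x c) m) (fun c => ?_) l).mono
      (unitSpan_pow_le h.sqFourier_commute hl m)
    · rw [Finset.prod_map_toList, Finset.prod_ite] at this
      simpa [Finset.filter_not, ← Finset.compl_eq_univ_sdiff, Finset.card_compl] using this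
    · split_ifs with hc
      · obtain ⟨w, hw⟩ := hΦ c hc
        exact spanCardLE_powSpan_of_pow_eq_zero (h.sqFourier_pow_eq_zero hψ hw) m
      · exact spanCardLE_powSpan _ m
  have key := ((h.spanCardLE_span_pow.mul (hD.mul hN)).mono
    (h.pow_le (one_mem_unitSpan _) hsq hcomm hl m)).finrank_le
  refine key.trans ?_
  calc n * ((2 * n) ^ Φ.card * (m + 1) ^ (n - Φ.card) * N)
      ≤ n * ((2 * n) ^ Φ.card * (m + 1) ^ (n - Φ.card) * (N + 1)) := by gcongr; omega
    _ = n * (2 * n) ^ Φ.card * (N + 1) * (m + 1) ^ (n - Φ.card) := by ring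

open Filter in
/-- Polynomial growth of degree `d` bounds the Gelfand–Kirillov dimension by `d`. -/
lemma gkdim_le_of_finrank_le {V : Submodule k B} {C d : ℕ} (hC : 0 < C)
    (h : ∀ m : ℕ, Module.finrank k ↥(V ^ m) ≤ C * (m + 1) ^ d) : gkdim k B V ≤ d := by
  have hlim : Tendsto (fun m : ℕ => (Real.log (C * 2 ^ d)) / Real.log m + d) atTop
      (nhds (0 + d)) :=
    (tendsto_const_nhds.div_atTop
      (Real.tendsto_log_atTop.comp tendsto_natCast_atTop_atTop)).add tendsto_const_nhds
  rw [zero_add] at hlim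
  rw [gkdim, ← hlim.limsup_eq]
  refine limsup_le_limsup ?_ ?_ hlim.isBoundedUnder_le
  · filter_upwards [eventually_ge_atTop 2] with m hm
    have hm' : (2 : ℝ) ≤ m := by exact_mod_cast hm
    have hlog : 0 < Real.log m := Real.log_pos (by linarith)
    have hC' : (1 : ℝ) ≤ C := by exact_mod_cast hC
    rw [div_add' _ _ _ hlog.ne', div_le_div_iff_of_pos_right hlog, ← Real.log_pow,
      ← Real.log_mul (by positivity) (by positivity)]
    have hle : (Module.finrank k ↥(V ^ m) : ℝ) ≤ C * 2 ^ d * m ^ d := by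
      calc (Module.finrank k ↥(V ^ m) : ℝ) ≤ C * (m + 1) ^ d := by exact_mod_cast h m
        _ ≤ C * (2 * m) ^ d := by gcongr; linarith
        _ = C * 2 ^ d * m ^ d := by ring
    rcases Nat.eq_zero_or_pos (Module.finrank k ↥(V ^ m)) with h0 | h0
    · rw [h0, Nat.cast_zero, Real.log_zero]
      refine Real.log_nonneg (one_le_mul_of_one_le_of_one_le
        (one_le_mul_of_one_le_of_one_le hC' (one_le_pow₀ one_le_two)) (one_le_pow₀ (by linarith)))
    · exact Real.log_le_log (by exact_mod_cast h0) hle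
  · refine IsBoundedUnder.isCoboundedUnder_le ⟨0, eventually_map.mpr ?_⟩
    refine Eventually.of_forall fun m => ?_
    exact div_nonneg (Real.log_natCast_nonneg _) (Real.log_natCast_nonneg _)

end Growth

section Quotient

variable (k : Type*) [Field k] (n : ℕ)

/-- The quotient map `A # C_n → E`. -/
noncomputable abbrev toEquot : SkewGroup k n →ₐ[k] Equot k n :=
  RingQuot.mkAlgHom k fun a b : SkewGroup k n => a = e0 k n ∧ b = 0

lemma isSkewCyclic_toEquot [CharZero k] [NeZero n] :
    IsSkewCyclic (fun i => toEquot k n (xg k n i)) (toEquot k n (sg k n)) where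
  anti i j hij := by
    have := RingQuot.mkAlgHom_rel k (SGRel.anti (k := k) i j hij)
    simp only [map_add, map_mul, map_zero] at this
    rw [← map_mul, ← map_mul, ← map_add, xg, xg, this, map_zero]
  s_pow := by
    have := RingQuot.mkAlgHom_rel k (SGRel.spow (k := k) (n := n))
    rw [map_pow, map_one] at this
    rw [← map_pow, sg, this, map_one]
  s_comm i := by
    have := RingQuot.mkAlgHom_rel k (SGRel.scomm (k := k) i)
    rw [map_mul, map_mul] at this
    rw [← map_mul, ← map_mul, sg, xg, xg, this]
  sum_pow := by
    have h : toEquot k n ((n : k)⁻¹ • ∑ i ∈ Finset.range n, sg k n ^ i) = toEquot k n 0 :=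
      RingQuot.mkAlgHom_rel k ⟨rfl, rfl⟩
    rw [map_zero, map_smul, map_sum] at h
    simpa using (smul_eq_zero.mp h).resolve_left (inv_ne_zero (NeZero.ne _))

end Quotient

end NCIS

open NCIS in
/-- Theorem 0.7 / Proposition 2.3(3): for every `n ≥ 2`,
`GKdim E ≤ n − |φ₂(n)|`, where `φ₂(n) = {m : 0 ≤ m ≤ n−1, gcd(m,n) = 2^w for some w ≥ 0}`. -/
theorem gkdim_skewGroup_quotient_le
    (k : Type*) [Field k] [IsAlgClosed k] [CharZero k]
    (n : ℕ) (hn2 : 2 ≤ n) :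
    gkdim k (Equot k n) (Vgen k n) ≤
      (n : ℝ) - ({m : ℕ | m ≤ n - 1 ∧ ∃ w : ℕ, Nat.gcd m n = 2 ^ w}.ncard : ℝ) := by
  have : NeZero n := ⟨by omega⟩
  obtain ⟨ζ, hζ⟩ := HasEnoughRootsOfUnity.exists_primitiveRoot k n
  classical
  set Φ : Finset (ZMod n) := {c | ∃ w : ℕ, Nat.gcd c.val n = 2 ^ w} with hΦ
  have hcard : {m : ℕ | m ≤ n - 1 ∧ ∃ w : ℕ, Nat.gcd m n = 2 ^ w}.ncard = Φ.card := by
    rw [← Set.ncard_coe_finset, ← Set.ncard_image_of_injective _ (ZMod.val_injective n)]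
    congr 1
    ext m
    simp only [hΦ, Set.mem_ofPred_eq, Finset.coe_filter, Finset.mem_univ, true_and, Set.mem_image]
    constructor
    · rintro ⟨hm, hw⟩
      have hval : (m : ZMod n).val = m := ZMod.val_cast_of_lt (by omega)
      exact ⟨m, by rwa [hval], hval⟩
    · rintro ⟨c, hw, rfl⟩
      exact ⟨by have := c.val_lt; omega, hw⟩
  obtain ⟨C, hC, h⟩ := (isSkewCyclic_toEquot k n).exists_finrank_pow_le
    (AddChar.zmodChar_primitive_of_primitive_root n hζ) Φ (by simp [hΦ])
  have hle : Φ.card ≤ n := (Finset.card_le_univ Φ).trans_eq (ZMod.card n)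
  rw [hcard, ← Nat.cast_sub hle]
  exact gkdim_le_of_finrank_le hC h
end

section
/- Let n ≥ 2 with n ≠ 3 and n ≠ 5. Let Ā := A/I where I is the two-sided ideal of A generated by the central elements c_k for all k ∈ ℤ/nℤ with k ≠ 0; the C_n-action descends to Ā. Let R̄₁ := {a ∈ Ā : σ·a = ω^{−1} a} and let R̄₁Ā denote the right ideal of Ā generated by R̄₁. Then the image of c₀^{n−1} in Ā lies in R̄₁Ā. -/
open scoped BigOperators

namespace NCIS

variable (k : Type*) [Field k] (n : ℕ)

/-- Relations defining the `(-1)`-skew polynomial ring `A = k_{-1}[x_0, …, x_{n-1}]`: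
`x_i x_j + x_j x_i = 0` for all `i ≠ j` in `ℤ/n`. -/
inductive ARel : FreeAlgebra k (ZMod n) → FreeAlgebra k (ZMod n) → Prop
  | anti (i j : ZMod n) (h : i ≠ j) :
      ARel (FreeAlgebra.ι k i * FreeAlgebra.ι k j + FreeAlgebra.ι k j * FreeAlgebra.ι k i) 0

/-- The `(-1)`-skew polynomial ring `A = k_{-1}[x_0, …, x_{n-1}]`. -/
abbrev SkewPoly := RingQuot (ARel k n)

/-- The image of the generator `x_i` in `A`. -/
noncomputable def xA (i : ZMod n) : SkewPoly k n :=
  RingQuot.mkAlgHom k (ARel k n) (FreeAlgebra.ι k i)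

/-- The eigenvector `b_γ = (1/n) ∑_{i=0}^{n-1} ω^{iγ} x_i ∈ A`. -/
noncomputable def bA (ω : k) (γ : ZMod n) : SkewPoly k n :=
  (n : k)⁻¹ • ∑ i ∈ Finset.range n, ω ^ (i * γ.val) • xA k n (i : ZMod n)

/-- The central element `c_j = (2/n²) ∑_{i=0}^{n-1} ω^{ij} x_i² ∈ A`. -/
noncomputable def cA (ω : k) (j : ZMod n) : SkewPoly k n :=
  (2 / (n : k) ^ 2) • ∑ i ∈ Finset.range n, ω ^ (i * j.val) • xA k n (i : ZMod n) ^ 2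

/-- The algebra automorphism `σ` of `A` determined by `σ(x_i) = x_{i+1}`, generating the
action of the cyclic group `C_n` on `A`. -/
noncomputable def sigmaA : SkewPoly k n →ₐ[k] SkewPoly k n :=
  RingQuot.liftAlgHom k
    ⟨(RingQuot.mkAlgHom k (ARel k n)).comp
        (FreeAlgebra.lift k (fun i : ZMod n => FreeAlgebra.ι k (i + 1))), by
      intro x y h
      induction h with
      | anti i j hij =>
        have hne : i + 1 ≠ j + 1 := fun hc => hij (by exact add_left_injective 1 hc)
        have := RingQuot.mkAlgHom_rel k (ARel.anti (k := k) (n := n) (i + 1) (j + 1) hne)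
        simpa using this⟩

/-- The `ω^{-j}`-eigenspace `R_j = {a ∈ A : σ·a = ω^{−j} a}` of the `C_n`-action on `A`. -/
def Rcomp (ω : k) (j : ZMod n) : Set (SkewPoly k n) :=
  {a : SkewPoly k n | sigmaA k n a = (ω ^ j.val)⁻¹ • a}

/-- The right ideal `R_j A` of `A` generated by `R_j`. -/
noncomputable def RcompA (ω : k) (j : ZMod n) : Submodule k (SkewPoly k n) :=
  Submodule.span k {y : SkewPoly k n | ∃ r ∈ Rcomp k n ω j, ∃ a : SkewPoly k n, y = r * a}

end NCIS

namespace NCIS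

variable (k : Type*) [Field k] (n : ℕ)

/-- The element `c_m = (2/n²) ∑_{i=0}^{n-1} ω^{im} x_i²` of the free algebra. -/
noncomputable def cFree (ω : k) (m : ZMod n) : FreeAlgebra k (ZMod n) :=
  (2 / (n : k) ^ 2) •
    ∑ i ∈ Finset.range n, ω ^ (i * m.val) • FreeAlgebra.ι k ((i : ZMod n)) ^ 2

/-- Relations defining `Ā = A / (c_m : m ≠ 0)`: the skew-commutation relations of `A`
together with the vanishing of the central elements `c_m` for all `m ≠ 0`. -/
inductive AbarRel (ω : k) : FreeAlgebra k (ZMod n) → FreeAlgebra k (ZMod n) → Prop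
  | anti (i j : ZMod n) (h : i ≠ j) :
      AbarRel ω (FreeAlgebra.ι k i * FreeAlgebra.ι k j
        + FreeAlgebra.ι k j * FreeAlgebra.ι k i) 0
  | czero (m : ZMod n) (h : m ≠ 0) : AbarRel ω (cFree k n ω m) 0

/-- The quotient algebra `Ā = A / (c_m : m ≠ 0)`. -/
abbrev Abar (ω : k) := RingQuot (AbarRel k n ω)

end NCIS

namespace NCIS

section WeightIdeal

variable {k A : Type*} [Field k] [Ring A] [Algebra k A]

/-- The right ideal generated by the eigenvectors of `σ` with eigenvalue `ω⁻ᵈ`. -/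
def weightIdeal (σ : A →ₐ[k] A) (ω : k) (d : ℤ) : Submodule k A :=
  Submodule.span k {y : A | ∃ r : A, σ r = ω ^ (-d) • r ∧ ∃ a : A, y = r * a}

variable {σ : A →ₐ[k] A} {ω : k}

theorem mul_mem_weightIdeal_right {d : ℤ} {x : A} (hx : x ∈ weightIdeal σ ω d) (a : A) :
    x * a ∈ weightIdeal σ ω d := by
  induction hx using Submodule.span_induction with
  | mem x hx =>
    obtain ⟨r, hr, a', rfl⟩ := hx
    exact Submodule.subset_span ⟨r, hr, a' * a, mul_assoc _ _ _⟩
  | zero => simp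
  | add x y _ _ hx hy => rw [add_mul]; exact add_mem hx hy
  | smul t x _ hx => rw [smul_mul_assoc]; exact Submodule.smul_mem _ _ hx

theorem mul_mem_weightIdeal_left (hω : ω ≠ 0) {d e f : ℤ} {r x : A} (hr : σ r = ω ^ (-e) • r)
    (hx : x ∈ weightIdeal σ ω d) (hf : f = e + d) : r * x ∈ weightIdeal σ ω f := by
  subst hf
  induction hx using Submodule.span_induction with
  | mem x hx =>
    obtain ⟨s, hs, a, rfl⟩ := hx
    refine Submodule.subset_span ⟨r * s, ?_, a, (mul_assoc _ _ _).symm⟩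
    rw [map_mul, hr, hs, smul_mul_smul_comm, ← zpow_add₀ hω, neg_add]
  | zero => simp
  | add x y _ _ hx hy => rw [mul_add]; exact add_mem hx hy
  | smul t x _ hx => rw [mul_smul_comm]; exact Submodule.smul_mem _ _ hx

theorem one_mem_weightIdeal_zero : (1 : A) ∈ weightIdeal σ ω 0 :=
  Submodule.subset_span ⟨1, by simp, 1, by simp⟩

theorem weightIdeal_add_mul {n : ℕ} (hω : ω ≠ 0) (hn : ω ^ n = 1) (d q : ℤ) :
    weightIdeal σ ω (d + n * q) = weightIdeal σ ω d := by
  have h : ω ^ (-(d + n * q)) = ω ^ (-d) := by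
    rw [neg_add, zpow_add₀ hω, zpow_neg ω (n * q), zpow_mul, zpow_natCast, hn]
    simp
  simp only [weightIdeal, h]

theorem mem_weightIdeal_one_of_interval {n N : ℕ} (hω : ω ≠ 0) (hn : ω ^ n = 1)
    (hpos : 0 < n) (hN : n ≤ N + 1) {x : A} {a : ℤ}
    (hx : ∀ j : ℕ, j ≤ N → x ∈ weightIdeal σ ω (a + j)) : x ∈ weightIdeal σ ω 1 := by
  have hn' : (0 : ℤ) < n := by exact_mod_cast hpos
  have h0 := Int.emod_nonneg (1 - a) hn'.ne'
  have h1 := Int.emod_lt_of_pos (1 - a) hn'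
  have h2 := Int.emod_add_mul_ediv (1 - a) n
  obtain ⟨j, hj⟩ := Int.eq_ofNat_of_zero_le h0
  have := hx j (by omega)
  rw [← weightIdeal_add_mul hω hn _ ((1 - a) / n), ← hj] at this
  convert this using 2
  omega

theorem commute_mul_of_anticommute {x y z : A} (hx : x * z + z * x = 0) (hy : y * z + z * y = 0) :
    Commute (x * y) z := by
  have h1 := eq_neg_of_add_eq_zero_left hx
  have h2 := eq_neg_of_add_eq_zero_left hy
  rw [Commute, SemiconjBy, mul_assoc, h2, mul_neg, ← mul_assoc, h1, neg_mul, neg_neg, mul_assoc]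

theorem le_triangle (t : ℕ) : t ≤ t * (t + 1) / 2 := by
  rw [Nat.le_div_iff_mul_le (by norm_num)]
  rcases t with _ | t
  · simp
  · nlinarith

theorem triangle_succ (t : ℕ) : (t + 1) * (t + 1 + 1) / 2 = t * (t + 1) / 2 + (t + 1) := by
  rw [← Nat.add_mul_div_right _ _ (by norm_num : 0 < 2)]
  congr 1
  ring

/-- The elements lying in the weight ideals of an interval of `N + 1` weights and commuting with
`b j` for `t < j < n - t`. -/
def spreadSet (σ : A →ₐ[k] A) (ω : k) (b : ℕ → A) (n t N : ℕ) : Set A :=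
  {x | (∃ a : ℤ, ∀ j : ℕ, j ≤ N → x ∈ weightIdeal σ ω (a + j)) ∧
    ∀ j : ℕ, t < j → j + t < n → Commute x (b j)}

variable {b : ℕ → A} {c : A} {n : ℕ}

/-- Multiplying by a pair `p * q` of opposite weights `d = ±i` lengthens the interval of weights
by `i`. -/
theorem pair_mul_mem_interval (hω : ω ≠ 0) {p q : A} {N i : ℕ} {d : ℤ}
    (hp : σ p = ω ^ (-d) • p) (hpq : σ (p * q) = ω ^ (-(0 : ℤ)) • (p * q))
    (hd : d = i ∨ d = -i) (hi : i ≤ N + 1) {x : A} (hq : Commute x q)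
    (hx : ∃ a : ℤ, ∀ j : ℕ, j ≤ N → x ∈ weightIdeal σ ω (a + j)) :
    ∃ a : ℤ, ∀ j : ℕ, j ≤ N + i → p * q * x ∈ weightIdeal σ ω (a + j) := by
  obtain ⟨a, ha⟩ := hx
  have h0 : ∀ j : ℕ, j ≤ N → p * q * x ∈ weightIdeal σ ω (a + j) := fun j hj =>
    mul_mem_weightIdeal_left hω hpq (ha j hj) (zero_add _).symm
  have h1 : ∀ j : ℕ, j ≤ N → p * q * x ∈ weightIdeal σ ω (d + (a + j)) := fun j hj => by
    rw [mul_assoc, ← hq.eq, ← mul_assoc]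
    exact mul_mem_weightIdeal_right (mul_mem_weightIdeal_left hω hp (ha j hj) rfl) q
  rcases hd with rfl | rfl
  · refine ⟨a, fun j hj => ?_⟩
    rcases le_or_gt j N with h | h
    · exact h0 j h
    · convert h1 (j - i) (by omega) using 2
      omega
  · refine ⟨a - i, fun j hj => ?_⟩
    rcases le_or_gt j N with h | h
    · convert h1 j h using 2
      omega
    · convert h0 (j - i) (by omega) using 2
      omega

theorem pow_mem_span_spreadSet (hω : ω ≠ 0) (hn : ω ^ n = 1)
    (hb : ∀ p : ℕ, σ (b p) = ω ^ (-(p : ℤ)) • b p)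
    (hzero : ∀ p q : ℕ, ¬ n ∣ p + q → b p * b q + b q * b p = 0)
    (hc : ∀ p q : ℕ, n ∣ p + q → b p * b q + b q * b p = c) (t : ℕ) (ht : t = 0 ∨ 2 * t < n) :
    c ^ t ∈ Submodule.span k (spreadSet σ ω b n t (t * (t + 1) / 2)) := by
  induction t with
  | zero =>
    refine Submodule.subset_span ⟨⟨0, fun j hj => ?_⟩, fun j _ _ => ?_⟩
    · obtain rfl : j = 0 := by omega
      simpa using one_mem_weightIdeal_zero
    · rw [pow_zero]; exact Commute.one_left _
  | succ t ih =>
    obtain ⟨q, hq⟩ : ∃ q, t + 1 + q = n := ⟨n - (t + 1), by omega⟩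
    have hbq : σ (b q) = ω ^ (-(-((t + 1 : ℕ) : ℤ))) • b q := by
      rw [hb q]
      congr 1
      have : (-(q : ℤ)) = -(-((t + 1 : ℕ) : ℤ)) + -(n : ℤ) := by omega
      rw [this, zpow_add₀ hω, zpow_neg ω (n : ℤ), zpow_natCast ω n, hn]
      simp
    have hpq : ∀ {u v : A} {d : ℤ}, σ u = ω ^ (-d) • u → σ v = ω ^ (-(-d)) • v →
        σ (u * v) = ω ^ (-(0 : ℤ)) • (u * v) := by
      intro u v d hu hv
      rw [map_mul, hu, hv, smul_mul_smul_comm, ← zpow_add₀ hω]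
      congr 2
      ring
    have hanti : ∀ j : ℕ, t + 1 < j → j + (t + 1) < n →
        b (t + 1) * b j + b j * b (t + 1) = 0 ∧ b q * b j + b j * b q = 0 := by
      intro j h1 h2
      refine ⟨hzero _ _ fun h => ?_, hzero _ _ fun h => ?_⟩
      · exact absurd (Nat.le_of_dvd (by omega) h) (by omega)
      · obtain ⟨j', rfl⟩ := Nat.exists_eq_add_of_lt h1
        have : q + (t + 1 + j' + 1) = n + (j' + 1) := by omega
        rw [this, Nat.dvd_add_right (dvd_refl n)] at h
        exact absurd (Nat.le_of_dvd (by omega) h) (by omega)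
    rw [pow_succ', triangle_succ]
    have hle := le_triangle t
    have key : ∀ x ∈ Submodule.span k (spreadSet σ ω b n t (t * (t + 1) / 2)),
        c * x ∈ Submodule.span k
          (spreadSet σ ω b n (t + 1) (t * (t + 1) / 2 + (t + 1))) := by
      intro x hx
      induction hx using Submodule.span_induction with
      | mem x hx =>
        obtain ⟨hw, hcomm⟩ := hx
        rw [← hc (t + 1) q ⟨1, by omega⟩, add_mul]
        refine add_mem (Submodule.subset_span ⟨?_, ?_⟩) (Submodule.subset_span ⟨?_, ?_⟩)
        · exact pair_mul_mem_interval hω (hb (t + 1)) (hpq (hb (t + 1)) hbq) (Or.inl rfl)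
            (by omega) (hcomm q (by omega) (by omega)) hw
        · intro j h1 h2
          obtain ⟨e1, e2⟩ := hanti j h1 h2
          exact (commute_mul_of_anticommute e1 e2).mul_left (hcomm j (by omega) (by omega))
        · exact pair_mul_mem_interval hω hbq (hpq hbq (by rw [neg_neg]; exact hb (t + 1)))
            (Or.inr rfl) (by omega) (hcomm (t + 1) (by omega) (by omega)) hw
        · intro j h1 h2
          obtain ⟨e1, e2⟩ := hanti j h1 h2
          exact (commute_mul_of_anticommute e2 e1).mul_left (hcomm j (by omega) (by omega))
      | zero => simp
      | add x y _ _ hx hy => rw [mul_add c]; exact add_mem hx hy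
      | smul s x _ hx => rw [mul_smul_comm]; exact Submodule.smul_mem _ _ hx
    exact key _ (ih (by omega))

theorem pow_mem_weightIdeal_one (hω : ω ≠ 0) (hn : ω ^ n = 1) (hn2 : 2 ≤ n) (h3 : n ≠ 3)
    (h5 : n ≠ 5) (hb : ∀ p : ℕ, σ (b p) = ω ^ (-(p : ℤ)) • b p)
    (hzero : ∀ p q : ℕ, ¬ n ∣ p + q → b p * b q + b q * b p = 0)
    (hc : ∀ p q : ℕ, n ∣ p + q → b p * b q + b q * b p = c) :
    c ^ (n - 1) ∈ weightIdeal σ ω 1 := by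
  obtain ⟨t, s, hts, hmem⟩ : ∃ t s : ℕ, t + s = n - 1 ∧ c ^ t ∈ weightIdeal σ ω 1 := by
    obtain ⟨m, hm | hm⟩ : ∃ m, n = 2 * m + 1 ∨ n = 2 * m + 2 := ⟨(n - 1) / 2, by omega⟩
    · refine ⟨m, m, by omega, ?_⟩
      have h := pow_mem_span_spreadSet hω hn hb hzero hc m (by omega)
      refine Submodule.span_le.mpr ?_ h
      rintro x ⟨⟨a, ha⟩, -⟩
      refine mem_weightIdeal_one_of_interval hω hn (by omega) ?_ ha
      obtain ⟨m', rfl⟩ : ∃ m', m = m' + 3 := ⟨m - 3, by omega⟩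
      have : 2 * (m' + 3) ≤ (m' + 3) * (m' + 3 + 1) / 2 := by
        rw [Nat.le_div_iff_mul_le (by norm_num)]
        nlinarith
      omega
    · refine ⟨m + 1, m, by omega, ?_⟩
      have h := pow_mem_span_spreadSet hω hn hb hzero hc m (by omega)
      have hle := le_triangle m
      rw [pow_succ']
      generalize c ^ m = y at h
      induction h using Submodule.span_induction with
      | mem x hx =>
        obtain ⟨hw, hcomm⟩ := hx
        have hsq : σ (b (m + 1) * b (m + 1)) = ω ^ (-(0 : ℤ)) • (b (m + 1) * b (m + 1)) := by
          rw [map_mul, hb, smul_mul_smul_comm, ← zpow_add₀ hω]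
          congr 1
          have : -((m + 1 : ℕ) : ℤ) + -((m + 1 : ℕ) : ℤ) = -(n : ℤ) := by omega
          rw [this, zpow_neg, zpow_natCast, hn]
          simp
        obtain ⟨a, ha⟩ := pair_mul_mem_interval hω (hb (m + 1)) hsq (Or.inl rfl) (by omega)
          (hcomm (m + 1) (by omega) (by omega)) hw
        have := mem_weightIdeal_one_of_interval hω hn (by omega) (by omega) ha
        rw [← hc (m + 1) (m + 1) ⟨1, by omega⟩, add_mul]
        exact add_mem this this
      | zero => simp
      | add x y _ _ hx hy => rw [mul_add]; exact add_mem hx hy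
      | smul s x _ hx => rw [mul_smul_comm]; exact Submodule.smul_mem _ _ hx
  rw [← hts, pow_add]
  exact mul_mem_weightIdeal_right hmem _

end WeightIdeal

theorem sum_range_shift {M : Type*} [AddCommMonoid M] {n : ℕ} (f : ℕ → M) (h : f n = f 0) :
    ∑ i ∈ Finset.range n, f (i + 1) = ∑ i ∈ Finset.range n, f i := by
  rcases n with _ | n
  · simp
  · rw [Finset.sum_range_succ, h, Finset.sum_range_succ']

section Generators

variable {k : Type*} [Field k] {n : ℕ} {A : Type*} [Ring A] [Algebra k A]

theorem smul_sum_shift {ω : k} (hn : ω ^ n = 1) (m : ℕ) (f : ZMod n → A) :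
    ω ^ m • ∑ i ∈ Finset.range n, ω ^ (i * m) • f ((i : ZMod n) + 1) =
      ∑ i ∈ Finset.range n, ω ^ (i * m) • f i := by
  rw [← sum_range_shift (fun i : ℕ => ω ^ (i * m) • f (i : ZMod n))
    (by simp [pow_mul, hn]), Finset.smul_sum]
  refine Finset.sum_congr rfl fun i _ => ?_
  rw [smul_smul, ← pow_add, Nat.cast_succ]
  congr 2
  ring

/-- The weighted sum `b_p = (1/n) ∑ i, ω ^ (i p) x_i` of a family of elements. -/
noncomputable def weightedSum (ω : k) (x : ZMod n → A) (p : ℕ) : A :=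
  (n : k)⁻¹ • ∑ i ∈ Finset.range n, ω ^ (i * p) • x i

theorem weightedSum_mul_add_mul (ω : k) (x : ZMod n → A)
    (hx : ∀ i j, i ≠ j → x i * x j + x j * x i = 0) (p q : ℕ) :
    weightedSum ω x p * weightedSum ω x q + weightedSum ω x q * weightedSum ω x p =
      (2 / (n : k) ^ 2) • ∑ i ∈ Finset.range n, ω ^ (i * (p + q)) • x i ^ 2 := by
  have hinj : ∀ i ∈ Finset.range n, ∀ j ∈ Finset.range n, i ≠ j → (i : ZMod n) ≠ j := by
    intro i hi j hj hij h
    rw [ZMod.natCast_eq_natCast_iff] at h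
    exact hij (h.eq_of_lt_of_lt (Finset.mem_range.1 hi) (Finset.mem_range.1 hj))
  unfold weightedSum
  rw [smul_mul_smul_comm, smul_mul_smul_comm, ← smul_add, Finset.sum_mul_sum, Finset.sum_mul_sum,
    Finset.sum_comm (s := Finset.range n) (t := Finset.range n)
      (f := fun i j => ω ^ (i * q) • x i * ω ^ (j * p) • x j), ← Finset.sum_add_distrib]
  have hsum : ∀ i ∈ Finset.range n,
      (∑ j ∈ Finset.range n, ω ^ (i * p) • x i * ω ^ (j * q) • x j) +
        ∑ j ∈ Finset.range n, ω ^ (j * q) • x j * ω ^ (i * p) • x i =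
      (2 : k) • ω ^ (i * (p + q)) • x i ^ 2 := by
    intro i hi
    rw [← Finset.sum_add_distrib, Finset.sum_eq_single_of_mem i hi]
    · rw [smul_mul_smul_comm, smul_mul_smul_comm, ← pow_add, ← pow_add, ← pow_two, mul_add,
        add_comm (i * q), two_smul]
    · intro j hj hji
      rw [smul_mul_smul_comm, smul_mul_smul_comm, mul_comm (ω ^ (j * q)), ← smul_add,
        hx _ _ (hinj i hi j hj hji.symm), smul_zero]
  rw [Finset.sum_congr rfl hsum, ← Finset.smul_sum, smul_smul]
  congr 1
  rw [div_eq_mul_inv, pow_two, mul_inv, mul_comm]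

end Generators

section Quotient

variable {k : Type*} [Field k] {n : ℕ} {ω : k}

theorem lift_cFree {A : Type*} [Ring A] [Algebra k A] (x : ZMod n → A) (m : ZMod n) :
    FreeAlgebra.lift k x (cFree k n ω m) =
      (2 / (n : k) ^ 2) • ∑ i ∈ Finset.range n, ω ^ (i * m.val) • x i ^ 2 := by
  simp [cFree]

variable (k n ω) in
/-- The image of the generator `x_i` in `Ā`. -/
noncomputable def xAbar (i : ZMod n) : Abar k n ω :=
  RingQuot.mkAlgHom k (AbarRel k n ω) (FreeAlgebra.ι k i)

theorem mkAlgHom_eq_lift :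
    RingQuot.mkAlgHom k (AbarRel k n ω) = FreeAlgebra.lift k (xAbar k n ω) := by
  ext i
  simp [xAbar]

theorem xAbar_anticommute (i j : ZMod n) (h : i ≠ j) :
    xAbar k n ω i * xAbar k n ω j + xAbar k n ω j * xAbar k n ω i = 0 := by
  simpa [xAbar] using RingQuot.mkAlgHom_rel k (AbarRel.anti (k := k) (n := n) (ω := ω) i j h)

theorem sum_xAbar_sq_eq_zero (m : ZMod n) (h : m ≠ 0) :
    (2 / (n : k) ^ 2) • ∑ i ∈ Finset.range n, ω ^ (i * m.val) • xAbar k n ω i ^ 2 = 0 := by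
  have := RingQuot.mkAlgHom_rel k (AbarRel.czero (k := k) (n := n) (ω := ω) m h)
  rwa [map_zero, mkAlgHom_eq_lift, lift_cFree] at this

theorem exists_shift_algHom (hω : ω ≠ 0) (hn : ω ^ n = 1) :
    ∃ σ : Abar k n ω →ₐ[k] Abar k n ω, ∀ i, σ (xAbar k n ω i) = xAbar k n ω (i + 1) := by
  refine ⟨RingQuot.liftAlgHom k
    ⟨FreeAlgebra.lift k (fun i => xAbar k n ω (i + 1)), ?_⟩, fun i => ?_⟩
  · intro u v h
    induction h with
    | anti i j hij =>
      simpa using xAbar_anticommute (i + 1) (j + 1) (fun h => hij (add_left_injective 1 h))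
    | czero m hm =>
      have h := sum_xAbar_sq_eq_zero (ω := ω) m hm
      rw [← smul_sum_shift hn m.val (fun i => xAbar k n ω i ^ 2), smul_comm] at h
      rw [map_zero, lift_cFree]
      exact (smul_eq_zero.1 h).resolve_left (pow_ne_zero _ hω)
  · simp [xAbar]

end Quotient

end NCIS

open NCIS in
/-- Proposition 6.6(1): let `n ≥ 2`, `n ≠ 3, 5`.  The automorphism `σ`
(determined by `x_i ↦ x_{i+1}`) descends to `Ā = A/(c_m : m ≠ 0)`, and, with
`R̄₁ = {a ∈ Ā : σ·a = ω⁻¹ a}`, the image of `c₀^{n−1}` in `Ā` lies in the right ideal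
`R̄₁Ā` generated by `R̄₁`. -/
theorem c0_pow_mem_rightIdeal_Rbar1
    (k : Type*) [Field k] [IsAlgClosed k] [CharZero k]
    (n : ℕ) (hn2 : 2 ≤ n) (h3 : n ≠ 3) (h5 : n ≠ 5)
    (ω : k) (hω : IsPrimitiveRoot ω n) :
    ∃ σb : Abar k n ω →ₐ[k] Abar k n ω,
      (∀ i : ZMod n,
        σb (RingQuot.mkAlgHom k (AbarRel k n ω) (FreeAlgebra.ι k i)) =
          RingQuot.mkAlgHom k (AbarRel k n ω) (FreeAlgebra.ι k (i + 1))) ∧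
      (RingQuot.mkAlgHom k (AbarRel k n ω) (cFree k n ω 0)) ^ (n - 1) ∈
        Submodule.span k
          {y : Abar k n ω | ∃ r : Abar k n ω, σb r = ω⁻¹ • r ∧ ∃ a : Abar k n ω, y = r * a} := by
  have hω0 : ω ≠ 0 := hω.ne_zero (by omega)
  have hn : ω ^ n = 1 := hω.pow_eq_one
  obtain ⟨σ, hσ⟩ := exists_shift_algHom (k := k) hω0 hn
  refine ⟨σ, hσ, ?_⟩
  have hval : ∀ i m : ℕ, ω ^ (i * (m : ZMod n).val) = ω ^ (i * m) := fun i m => by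
    rw [ZMod.val_natCast, mul_comm, pow_mul, mul_comm i, pow_mul, ← pow_eq_pow_mod m hn]
  have hcomm : ∀ p q : ℕ, weightedSum ω (xAbar k n ω) p * weightedSum ω (xAbar k n ω) q +
      weightedSum ω (xAbar k n ω) q * weightedSum ω (xAbar k n ω) p =
      RingQuot.mkAlgHom k (AbarRel k n ω) (cFree k n ω ((p + q : ℕ) : ZMod n)) := fun p q => by
    rw [weightedSum_mul_add_mul ω _ xAbar_anticommute, mkAlgHom_eq_lift, lift_cFree]
    simp only [hval]
  have h := pow_mem_weightIdeal_one (σ := σ) (b := weightedSum ω (xAbar k n ω))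
    (c := RingQuot.mkAlgHom k (AbarRel k n ω) (cFree k n ω 0)) hω0 hn hn2 h3 h5 ?_ ?_ ?_
  · simpa only [weightIdeal, zpow_neg_one] using h
  · intro p
    rw [zpow_neg, zpow_natCast, eq_inv_smul_iff₀ (pow_ne_zero p hω0)]
    simp only [weightedSum, map_smul, map_sum, hσ]
    rw [smul_comm, smul_sum_shift hn p (xAbar k n ω)]
  · intro p q hpq
    rw [hcomm, mkAlgHom_eq_lift, lift_cFree]
    exact sum_xAbar_sq_eq_zero _ (by rwa [Ne, ZMod.natCast_eq_zero_iff])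
  · intro p q hpq
    rw [hcomm, (ZMod.natCast_eq_zero_iff _ _).2 hpq]
end
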